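/- arXiv:math/0010054 — 4 statements merged into one kernel-verified Lean document; each statement's English description precedes it below -/
import Mathlib

section
/- For Ω ∈ Λ³W*, one has λ(Ω) < 0 if and only if there exists a decomposable complex 3-form α on the complexification W ⊗ ℂ with α ∧ ᾱ ≠ 0 and Ω = α + ᾱ. -/
open scoped TensorProduct

noncomputable section

/-- The wedge product of alternating forms valued in a commutative algebra,
obtained from `AlternatingMap.domCoprod` (the sum over shuffles, so that the
wedge of covectors is given by a determinant). -/
def wedge {R A M : Type*} [CommRing R] [CommRing A] [Algebra R A]
    [AddCommGroup M] [Module R M] {m n : ℕ}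
    (α : AlternatingMap R M A (Fin m)) (β : AlternatingMap R M A (Fin n)) :
    AlternatingMap R M A (Fin (m + n)) :=
  (LinearMap.mul' R A).compAlternatingMap
    ((α.domCoprod β).domDomCongr finSumFinEquiv)

/-- A linear map regarded as an alternating 1-form. -/
def oneForm {R A M : Type*} [CommRing R] [CommRing A] [Algebra R A]
    [AddCommGroup M] [Module R M] (ξ : M →ₗ[R] A) : AlternatingMap R M A (Fin 1) :=
  AlternatingMap.ofSubsingleton R M A 0 ξ

/-- A 3-form is decomposable if it is the wedge of three covectors. -/
def IsDecomposable {R A M : Type*} [CommRing R] [CommRing A] [Algebra R A]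
    [AddCommGroup M] [Module R M] (α : AlternatingMap R M A (Fin 3)) : Prop :=
  ∃ ξ₁ ξ₂ ξ₃ : M →ₗ[R] A,
    α = wedge (oneForm ξ₁) (wedge (oneForm ξ₂) (oneForm ξ₃))
/-- The complexification of a real alternating form on `W`, i.e. the
`ℂ`-valued form corresponding to the complex-multilinear extension to `W ⊗ ℂ`
(a complex `n`-form on `W ⊗ ℂ` is uniquely determined by its restriction to
`W`, an `ℝ`-multilinear `ℂ`-valued alternating form). -/
def cx {W : Type*} [AddCommGroup W] [Module ℝ W] {n : ℕ}
    (Ω : AlternatingMap ℝ W ℝ (Fin n)) : AlternatingMap ℝ W ℂ (Fin n) :=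
  (Algebra.linearMap ℝ ℂ).compAlternatingMap Ω

/-- The conjugate of a complex alternating form (corresponding to the
conjugation of complex forms induced by the real structure on `W ⊗ ℂ`). -/
def conjForm {W : Type*} [AddCommGroup W] [Module ℝ W] {n : ℕ}
    (α : AlternatingMap ℝ W ℂ (Fin n)) : AlternatingMap ℝ W ℂ (Fin n) :=
  (Complex.conjAe.toLinearMap).compAlternatingMap α

open Equiv in
theorem wedge_transversal {R A M : Type*} [CommRing R] [CommRing A] [Algebra R A]
    [AddCommGroup M] [Module R M] {m n N : ℕ}
    (s : Fin N → Perm (Fin m ⊕ Fin n))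
    (hcard : N * (m.factorial * n.factorial) = (m + n).factorial)
    (hs : ∀ i j, (∀ x : Fin m, (((s i)⁻¹ * s j) (Sum.inl x)).isLeft = true) → i = j)
    (α : AlternatingMap R M A (Fin m)) (β : AlternatingMap R M A (Fin n))
    (v : Fin (m + n) → M) :
    wedge α β v = ∑ k, ((Perm.sign (s k) : ℤ) : A) *
      (α (fun i => v (finSumFinEquiv (s k (Sum.inl i)))) *
        β (fun i => v (finSumFinEquiv (s k (Sum.inr i))))) := by
  classical
  let q : Fin N → Perm.ModSumCongr (Fin m) (Fin n) := fun k => Quotient.mk'' (s k)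
  have hinj : Function.Injective q := by
    intro i j hij
    apply hs
    have := QuotientGroup.leftRel_apply.mp (Quotient.exact' hij)
    obtain ⟨⟨sl, sr⟩, h⟩ := this
    intro x
    rw [← h]
    simp
  have hbij : Function.Bijective q := by
    rw [Fintype.bijective_iff_injective_and_card]
    refine ⟨hinj, ?_⟩
    have h1 := Subgroup.card_eq_card_quotient_mul_card_subgroup
      (Perm.sumCongrHom (Fin m) (Fin n)).range
    rw [Nat.card_eq_fintype_card, Nat.card_eq_fintype_card, Nat.card_eq_fintype_card,
      Perm.sumCongrHom.card_range, Fintype.card_perm, Fintype.card_prod, Fintype.card_perm,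
      Fintype.card_perm] at h1
    simp only [Fintype.card_sum, Fintype.card_fin] at h1
    rw [← hcard] at h1
    rw [Fintype.card_fin]
    exact Nat.eq_of_mul_eq_mul_right (by positivity) h1
  unfold wedge
  simp only [LinearMap.compAlternatingMap_apply, AlternatingMap.domDomCongr_apply,
    AlternatingMap.domCoprod_apply]
  rw [_root_.sum_apply, map_sum, ← hbij.sum_comp]
  refine Finset.sum_congr rfl fun k _ => ?_
  change (LinearMap.mul' R A) (AlternatingMap.domCoprod.summand α β (Quotient.mk'' (s k)) _) = _
  rw [AlternatingMap.domCoprod.summand_mk'']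
  simp only [_root_.smul_apply, MultilinearMap.domDomCongr_apply,
    MultilinearMap.domCoprod_apply]
  rcases Int.units_eq_one_or (Perm.sign (s k)) with h | h <;> rw [h] <;> simp

theorem vcomp1 {I M : Type*} (v : I → M) (a : I) :
    v ∘ ![a] = ![v a] := by
  funext i; fin_cases i <;> rfl

theorem vcomp2 {I M : Type*} (v : I → M) (a b : I) :
    v ∘ ![a, b] = ![v a, v b] := by
  funext i; fin_cases i <;> rfl

theorem vcomp3 {I M : Type*} (v : I → M) (a b c : I) :
    v ∘ ![a, b, c] = ![v a, v b, v c] := by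
  funext i; fin_cases i <;> rfl

theorem vcomp5 {I M : Type*} (v : I → M) (a b c d e : I) :
    v ∘ ![a, b, c, d, e] = ![v a, v b, v c, v d, v e] := by
  funext i; fin_cases i <;> rfl

theorem vcomp2' {I M : Type*} (v : I → M) (f : Fin (1 + 1) → I) :
    v ∘ f = (![v (f 0), v (f 1)] : Fin (1 + 1) → M) := by
  funext i; fin_cases i <;> rfl

theorem vcomp5' {I M : Type*} (v : I → M) (a b c d e : I) :
    v ∘ (![a, b, c, d, e] : Fin (2 + 3) → I) =
      (![v a, v b, v c, v d, v e] : Fin (2 + 3) → M) := vcomp5 v a b c d e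


theorem wedge_table {R A M : Type*} [CommRing R] [CommRing A] [Algebra R A]
    [AddCommGroup M] [Module R M] {m n N : ℕ}
    (s : Fin N → Equiv.Perm (Fin m ⊕ Fin n))
    (hcard : N * (m.factorial * n.factorial) = (m + n).factorial)
    (hs : ∀ i j, (∀ x : Fin m, (((s i)⁻¹ * s j) (Sum.inl x)).isLeft = true) → i = j)
    (sg : Fin N → ℤ) (l : Fin N → Fin m → Fin (m + n)) (r : Fin N → Fin n → Fin (m + n))
    (hsg : ∀ k, (Equiv.Perm.sign (s k) : ℤ) = sg k)
    (hl : ∀ k i, finSumFinEquiv (s k (Sum.inl i)) = l k i)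
    (hr : ∀ k i, finSumFinEquiv (s k (Sum.inr i)) = r k i)
    (α : AlternatingMap R M A (Fin m)) (β : AlternatingMap R M A (Fin n))
    (v : Fin (m + n) → M) :
    wedge α β v = ∑ k, (sg k : A) * (α (v ∘ l k) * β (v ∘ r k)) := by
  rw [wedge_transversal s hcard hs]
  refine Finset.sum_congr rfl fun k _ => ?_
  rw [hsg]
  congr 3
  · funext i; simp [hl]
  · funext i; simp [hr]


open Equiv in
theorem wedge11 {R A M : Type*} [CommRing R] [CommRing A] [Algebra R A]
    [AddCommGroup M] [Module R M]
    (α : AlternatingMap R M A (Fin 1)) (β : AlternatingMap R M A (Fin 1))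
    (v : Fin (1 + 1) → M) :
    wedge α β v = α ![v 0] * β ![v 1]
      - α ![v 1] * β ![v 0] := by
  refine (wedge_table (R := R) (A := A) (M := M) (m := 1) (n := 1) (N := 2)
    ![1,
      swap (.inl 0) (.inr 0)]
    (by decide) (by decide +kernel)
    ![1, -1]
    ![![0], ![1]]
    ![![1], ![0]]
    (by decide +kernel) (by decide +kernel) (by decide +kernel) α β v).trans ?_
  simp only [Fin.sum_univ_succ, Fin.sum_univ_zero, Matrix.cons_val_zero, Matrix.cons_val_succ]
  simp only [vcomp1]
  push_cast
  ring


open Equiv in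
theorem wedge12 {R A M : Type*} [CommRing R] [CommRing A] [Algebra R A]
    [AddCommGroup M] [Module R M]
    (α : AlternatingMap R M A (Fin 1)) (β : AlternatingMap R M A (Fin (1 + 1)))
    (v : Fin (1 + (1 + 1)) → M) :
    wedge α β v = α ![v 0] * β ![v 1, v 2]
      - α ![v 1] * β ![v 0, v 2]
      - α ![v 2] * β ![v 1, v 0] := by
  refine (wedge_table (R := R) (A := A) (M := M) (m := 1) (n := (1 + 1)) (N := 3)
    ![1,
      swap (.inl 0) (.inr 0),
      swap (.inl 0) (.inr 1)]
    (by decide) (by decide +kernel)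
    ![1, -1, -1]
    ![![0], ![1], ![2]]
    ![![1, 2], ![0, 2], ![1, 0]]
    (by decide +kernel) (by decide +kernel) (by decide +kernel) α β v).trans ?_
  simp only [Fin.sum_univ_succ, Fin.sum_univ_zero, Matrix.cons_val_zero, Matrix.cons_val_succ]
  simp only [vcomp1, vcomp2', Matrix.cons_val]
  push_cast
  ring


open Equiv in
theorem wedge15 {R A M : Type*} [CommRing R] [CommRing A] [Algebra R A]
    [AddCommGroup M] [Module R M]
    (α : AlternatingMap R M A (Fin 1)) (β : AlternatingMap R M A (Fin (2 + 3)))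
    (v : Fin (1 + (2 + 3)) → M) :
    wedge α β v = α ![v 0] * β ![v 1, v 2, v 3, v 4, v 5]
      - α ![v 1] * β ![v 0, v 2, v 3, v 4, v 5]
      - α ![v 2] * β ![v 1, v 0, v 3, v 4, v 5]
      - α ![v 3] * β ![v 1, v 2, v 0, v 4, v 5]
      - α ![v 4] * β ![v 1, v 2, v 3, v 0, v 5]
      - α ![v 5] * β ![v 1, v 2, v 3, v 4, v 0] := by
  refine (wedge_table (R := R) (A := A) (M := M) (m := 1) (n := (2 + 3)) (N := 6)
    ![1,
      swap (.inl 0) (.inr 0),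
      swap (.inl 0) (.inr 1),
      swap (.inl 0) (.inr 2),
      swap (.inl 0) (.inr 3),
      swap (.inl 0) (.inr 4)]
    (by decide) (by decide +kernel)
    ![1, -1, -1, -1, -1, -1]
    ![![0], ![1], ![2], ![3], ![4], ![5]]
    ![![1, 2, 3, 4, 5], ![0, 2, 3, 4, 5], ![1, 0, 3, 4, 5], ![1, 2, 0, 4, 5], ![1, 2, 3, 0, 5], ![1, 2, 3, 4, 0]]
    (by decide +kernel) (by decide +kernel) (by decide +kernel) α β v).trans ?_
  simp only [Fin.sum_univ_succ, Fin.sum_univ_zero, Matrix.cons_val_zero, Matrix.cons_val_succ]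
  simp only [vcomp1, vcomp5']
  push_cast
  ring


open Equiv in
theorem wedge23 {R A M : Type*} [CommRing R] [CommRing A] [Algebra R A]
    [AddCommGroup M] [Module R M]
    (α : AlternatingMap R M A (Fin 2)) (β : AlternatingMap R M A (Fin 3))
    (v : Fin (2 + 3) → M) :
    wedge α β v = α ![v 0, v 1] * β ![v 2, v 3, v 4]
      - α ![v 2, v 1] * β ![v 0, v 3, v 4]
      - α ![v 3, v 1] * β ![v 2, v 0, v 4]
      - α ![v 4, v 1] * β ![v 2, v 3, v 0]
      - α ![v 0, v 2] * β ![v 1, v 3, v 4]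
      - α ![v 0, v 3] * β ![v 2, v 1, v 4]
      - α ![v 0, v 4] * β ![v 2, v 3, v 1]
      + α ![v 2, v 3] * β ![v 0, v 1, v 4]
      + α ![v 2, v 4] * β ![v 0, v 3, v 1]
      + α ![v 3, v 4] * β ![v 2, v 0, v 1] := by
  refine (wedge_table (R := R) (A := A) (M := M) (m := 2) (n := 3) (N := 10)
    ![1,
      swap (.inl 0) (.inr 0),
      swap (.inl 0) (.inr 1),
      swap (.inl 0) (.inr 2),
      swap (.inl 1) (.inr 0),
      swap (.inl 1) (.inr 1),
      swap (.inl 1) (.inr 2),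
      swap (.inl 0) (.inr 0) * swap (.inl 1) (.inr 1),
      swap (.inl 0) (.inr 0) * swap (.inl 1) (.inr 2),
      swap (.inl 0) (.inr 1) * swap (.inl 1) (.inr 2)]
    (by decide) (by decide +kernel)
    ![1, -1, -1, -1, -1, -1, -1, 1, 1, 1]
    ![![0, 1], ![2, 1], ![3, 1], ![4, 1], ![0, 2], ![0, 3], ![0, 4], ![2, 3], ![2, 4], ![3, 4]]
    ![![2, 3, 4], ![0, 3, 4], ![2, 0, 4], ![2, 3, 0], ![1, 3, 4], ![2, 1, 4], ![2, 3, 1], ![0, 1, 4], ![0, 3, 1], ![2, 0, 1]]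
    (by decide +kernel) (by decide +kernel) (by decide +kernel) α β v).trans ?_
  simp only [Fin.sum_univ_succ, Fin.sum_univ_zero, Matrix.cons_val_zero, Matrix.cons_val_succ]
  simp only [vcomp2, vcomp3]
  push_cast
  ring


open Equiv in
theorem wedge33 {R A M : Type*} [CommRing R] [CommRing A] [Algebra R A]
    [AddCommGroup M] [Module R M]
    (α : AlternatingMap R M A (Fin 3)) (β : AlternatingMap R M A (Fin 3))
    (v : Fin (3 + 3) → M) :
    wedge α β v = α ![v 0, v 1, v 2] * β ![v 3, v 4, v 5]
      - α ![v 3, v 1, v 2] * β ![v 0, v 4, v 5]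
      - α ![v 4, v 1, v 2] * β ![v 3, v 0, v 5]
      - α ![v 5, v 1, v 2] * β ![v 3, v 4, v 0]
      - α ![v 0, v 3, v 2] * β ![v 1, v 4, v 5]
      - α ![v 0, v 4, v 2] * β ![v 3, v 1, v 5]
      - α ![v 0, v 5, v 2] * β ![v 3, v 4, v 1]
      - α ![v 0, v 1, v 3] * β ![v 2, v 4, v 5]
      - α ![v 0, v 1, v 4] * β ![v 3, v 2, v 5]
      - α ![v 0, v 1, v 5] * β ![v 3, v 4, v 2]
      + α ![v 3, v 4, v 2] * β ![v 0, v 1, v 5]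
      + α ![v 3, v 5, v 2] * β ![v 0, v 4, v 1]
      + α ![v 4, v 5, v 2] * β ![v 3, v 0, v 1]
      + α ![v 3, v 1, v 4] * β ![v 0, v 2, v 5]
      + α ![v 3, v 1, v 5] * β ![v 0, v 4, v 2]
      + α ![v 4, v 1, v 5] * β ![v 3, v 0, v 2]
      + α ![v 0, v 3, v 4] * β ![v 1, v 2, v 5]
      + α ![v 0, v 3, v 5] * β ![v 1, v 4, v 2]
      + α ![v 0, v 4, v 5] * β ![v 3, v 1, v 2]
      - α ![v 3, v 4, v 5] * β ![v 0, v 1, v 2] := by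
  refine (wedge_table (R := R) (A := A) (M := M) (m := 3) (n := 3) (N := 20)
    ![1,
      swap (.inl 0) (.inr 0),
      swap (.inl 0) (.inr 1),
      swap (.inl 0) (.inr 2),
      swap (.inl 1) (.inr 0),
      swap (.inl 1) (.inr 1),
      swap (.inl 1) (.inr 2),
      swap (.inl 2) (.inr 0),
      swap (.inl 2) (.inr 1),
      swap (.inl 2) (.inr 2),
      swap (.inl 0) (.inr 0) * swap (.inl 1) (.inr 1),
      swap (.inl 0) (.inr 0) * swap (.inl 1) (.inr 2),
      swap (.inl 0) (.inr 1) * swap (.inl 1) (.inr 2),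
      swap (.inl 0) (.inr 0) * swap (.inl 2) (.inr 1),
      swap (.inl 0) (.inr 0) * swap (.inl 2) (.inr 2),
      swap (.inl 0) (.inr 1) * swap (.inl 2) (.inr 2),
      swap (.inl 1) (.inr 0) * swap (.inl 2) (.inr 1),
      swap (.inl 1) (.inr 0) * swap (.inl 2) (.inr 2),
      swap (.inl 1) (.inr 1) * swap (.inl 2) (.inr 2),
      swap (.inl 0) (.inr 0) * swap (.inl 1) (.inr 1) * swap (.inl 2) (.inr 2)]
    (by decide) (by decide +kernel)
    ![1, -1, -1, -1, -1, -1, -1, -1, -1, -1, 1, 1, 1, 1, 1, 1, 1, 1, 1, -1]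
    ![![0, 1, 2], ![3, 1, 2], ![4, 1, 2], ![5, 1, 2], ![0, 3, 2], ![0, 4, 2], ![0, 5, 2], ![0, 1, 3], ![0, 1, 4], ![0, 1, 5], ![3, 4, 2], ![3, 5, 2], ![4, 5, 2], ![3, 1, 4], ![3, 1, 5], ![4, 1, 5], ![0, 3, 4], ![0, 3, 5], ![0, 4, 5], ![3, 4, 5]]
    ![![3, 4, 5], ![0, 4, 5], ![3, 0, 5], ![3, 4, 0], ![1, 4, 5], ![3, 1, 5], ![3, 4, 1], ![2, 4, 5], ![3, 2, 5], ![3, 4, 2], ![0, 1, 5], ![0, 4, 1], ![3, 0, 1], ![0, 2, 5], ![0, 4, 2], ![3, 0, 2], ![1, 2, 5], ![1, 4, 2], ![3, 1, 2], ![0, 1, 2]]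
    (by decide +kernel) (by decide +kernel) (by decide +kernel) α β v).trans ?_
  simp only [Fin.sum_univ_succ, Fin.sum_univ_zero, Matrix.cons_val_zero, Matrix.cons_val_succ]
  simp only [vcomp3]
  push_cast
  ring


/-- Coefficients of `ι(e_j)Ω ∧ Ω` in terms of the coefficients of `Ω`. -/
def Bq (O : Fin 6 → Fin 6 → Fin 6 → ℝ) (j a b c d f : Fin 6) : ℝ :=
  O j a b * O c d f - O j c b * O a d f - O j d b * O c a f - O j f b * O c d a
    - O j a c * O b d f - O j a d * O c b f - O j a f * O c d b
    + O j c d * O a b f + O j c f * O a d b + O j d f * O c a b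

/-- Matrix of `K_Ω` (up to scale) in terms of the coefficients of `Ω`. -/
def Pm (O : Fin 6 → Fin 6 → Fin 6 → ℝ) : Fin 6 → Fin 6 → ℝ :=
  ![fun j => Bq O j 1 2 3 4 5, fun j => - Bq O j 0 2 3 4 5, fun j => - Bq O j 1 0 3 4 5,
    fun j => - Bq O j 1 2 0 4 5, fun j => - Bq O j 1 2 3 0 5, fun j => - Bq O j 1 2 3 4 0]

section poly
variable (O : Fin 6 → Fin 6 → Fin 6 → ℝ)

theorem Pm_all (h1 : ∀ i j k, O j i k = - O i j k) (h2 : ∀ i j k, O i k j = - O i j k) :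
    (∑ m, Pm O 0 m * Pm O m 1 = 0) ∧
    (∑ m, Pm O 0 m * Pm O m 0 = ∑ m, Pm O 1 m * Pm O m 1) ∧
    (∑ m, Pm O m 0 * O m 1 0 = 0) ∧
    (∑ m, Pm O m 0 * O m 1 2 = ∑ m, Pm O m 1 * O 0 m 2) := by
  have z1 : ∀ i k, O i i k = 0 := fun i k => by linarith [h1 i i k]
  have z2 : ∀ i k, O k i i = 0 := fun i k => by linarith [h2 k i i]
  have s1 : ∀ i j k, i < j → O j i k = - O i j k := fun i j k _ => h1 i j k
  have s2 : ∀ i j k, j < k → O i k j = - O i j k := fun i j k _ => h2 i j k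
  refine ⟨?_, ?_, ?_, ?_⟩ <;>
  · simp only [Fin.sum_univ_six, Pm, Bq, Matrix.cons_val, z1, z2]
    simp (disch := decide) only [s1, s2, z1, z2]
    ring

end poly

theorem alt3_swap12 {W A : Type*} [AddCommGroup W] [Module ℝ W] [AddCommGroup A] [Module ℝ A]
    (a : AlternatingMap ℝ W A (Fin 3)) (x y z : W) : a ![y, x, z] = - a ![x, y, z] := by
  have := a.map_swap ![x, y, z] (i := 0) (j := 1) (by decide)
  rw [← this]
  congr 1; funext i; fin_cases i <;> rfl

theorem alt3_swap23 {W A : Type*} [AddCommGroup W] [Module ℝ W] [AddCommGroup A] [Module ℝ A]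
    (a : AlternatingMap ℝ W A (Fin 3)) (x y z : W) : a ![x, z, y] = - a ![x, y, z] := by
  have := a.map_swap ![x, y, z] (i := 1) (j := 2) (by decide)
  rw [← this]
  congr 1; funext i; fin_cases i <;> rfl

theorem alt3_add1 {W A : Type*} [AddCommGroup W] [Module ℝ W] [AddCommGroup A] [Module ℝ A]
    (a : AlternatingMap ℝ W A (Fin 3)) (x x' y z : W) :
    a ![x + x', y, z] = a ![x, y, z] + a ![x', y, z] := by
  exact a.toMultilinearMap.cons_add ![y, z] x x'

theorem alt3_smul1 {W A : Type*} [AddCommGroup W] [Module ℝ W] [AddCommGroup A] [Module ℝ A]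
    (a : AlternatingMap ℝ W A (Fin 3)) (c : ℝ) (x y z : W) :
    a ![c • x, y, z] = c • a ![x, y, z] := by
  exact a.toMultilinearMap.cons_smul ![y, z] c x

/-- A 3-form as a linear map in its first argument. -/
def slot1 {W A : Type*} [AddCommGroup W] [Module ℝ W] [AddCommGroup A] [Module ℝ A]
    (a : AlternatingMap ℝ W A (Fin 3)) (y z : W) : W →ₗ[ℝ] A where
  toFun x := a ![x, y, z]
  map_add' x x' := alt3_add1 a x x' y z
  map_smul' c x := alt3_smul1 a c x y z

section geom
variable {W : Type*} [AddCommGroup W] [Module ℝ W]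

theorem coord_formula (ε : AlternatingMap ℝ W ℝ (Fin 6)) (T : W →ₗ[ℝ] W)
    (Ω : AlternatingMap ℝ W ℝ (Fin 3))
    (hT : ∀ (θ : W →ₗ[ℝ] ℝ) (v : W),
      wedge (oneForm θ) (wedge (Ω.curryLeft v) Ω) = θ (T v) • ε)
    (e : Module.Basis (Fin 6) ℝ W) (i j : Fin 6) :
    e.coord i (T (e j)) * ε e = Pm (fun a b c => Ω ![e a, e b, e c]) i j := by
  have h : wedge (oneForm (e.coord i)) (wedge (Ω.curryLeft (e j)) Ω) (fun i : Fin 6 => e i) =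
      e.coord i (T (e j)) * ε e := by
    rw [hT (e.coord i) (e j)]
    rfl
  rw [← h]
  have h15 := wedge15 (R := ℝ) (A := ℝ) (M := W) (oneForm (e.coord i))
    (wedge (Ω.curryLeft (e j)) Ω) (fun i : Fin 6 => e i)
  refine Eq.trans h15 ?_
  clear h15 h
  have hB : ∀ a b c d f : Fin 6, (wedge (Ω.curryLeft (e j)) Ω) ![e a, e b, e c, e d, e f] =
      Bq (fun a b c => Ω ![e a, e b, e c]) j a b c d f := by
    intro a b c d f
    exact wedge23 (R := ℝ) (A := ℝ) (M := W) (Ω.curryLeft (e j)) Ω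
      ![e a, e b, e c, e d, e f]
  have h1 : ∀ a : Fin 6, (oneForm (e.coord i)) ![e a] = if a = i then 1 else 0 := by
    intro a
    change e.coord i (e a) = _
    simp [Finsupp.single_apply]
  rw [hB, hB, hB, hB, hB, hB]
  simp only [h1]
  fin_cases i <;> simp [Pm]

theorem perm_triple : ∀ i j k : Fin 6, i ≠ j → i ≠ k → j ≠ k →
    ∃ σ : Equiv.Perm (Fin 6), σ 0 = i ∧ σ 1 = j ∧ σ 2 = k := by
  intro i j k hij hik hjk
  let s1 := Equiv.swap 0 i
  let s2 := Equiv.swap (s1 1) j * s1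
  refine ⟨Equiv.swap (s2 2) k * s2, ?_⟩
  revert i j k
  decide +kernel

theorem perm_pair (i j : Fin 6) (h : i ≠ j) :
    ∃ σ : Equiv.Perm (Fin 6), σ 0 = i ∧ σ 1 = j := by
  have : ∃ k : Fin 6, i ≠ k ∧ j ≠ k := by revert i j; decide
  obtain ⟨k, h1, h2⟩ := this
  obtain ⟨σ, a, b, _⟩ := perm_triple i j k h h1 h2
  exact ⟨σ, a, b⟩

theorem basis_facts (ε : AlternatingMap ℝ W ℝ (Fin 6)) (hε : ε ≠ 0) (T : W →ₗ[ℝ] W)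
    (Ω : AlternatingMap ℝ W ℝ (Fin 3))
    (hT : ∀ (θ : W →ₗ[ℝ] ℝ) (v : W),
      wedge (oneForm θ) (wedge (Ω.curryLeft v) Ω) = θ (T v) • ε)
    (e : Module.Basis (Fin 6) ℝ W) :
    e.coord 0 (T (T (e 1))) = 0 ∧ e.coord 0 (T (T (e 0))) = e.coord 1 (T (T (e 1))) ∧
    Ω ![T (e 0), e 1, e 0] = 0 ∧ Ω ![T (e 0), e 1, e 2] = Ω ![e 0, T (e 1), e 2] := by
  have hE : ε e ≠ 0 := (ε.map_basis_ne_zero_iff e).2 hε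
  have hc := coord_formula ε T Ω hT e
  obtain ⟨p1, p2, p3, p4⟩ := Pm_all (fun a b c => Ω ![e a, e b, e c])
    (fun i j k => alt3_swap12 Ω _ _ _) (fun i j k => alt3_swap23 Ω _ _ _)
  simp only [← hc] at p1 p2 p3 p4
  have hTe : ∀ j, T (e j) = ∑ m, e.coord m (T (e j)) • e m := fun j => by
    simpa using (e.sum_repr (T (e j))).symm
  have hTT : ∀ i j, e.coord i (T (T (e j))) =
      ∑ m, e.coord i (T (e m)) * e.coord m (T (e j)) := by
    intro i j
    conv_lhs => rw [hTe j]
    rw [map_sum, map_sum]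
    refine Finset.sum_congr rfl fun m _ => ?_
    rw [map_smul, map_smul, smul_eq_mul, mul_comm]
  have hO1 : ∀ j y z, Ω ![T (e j), y, z] = ∑ m, e.coord m (T (e j)) * Ω ![e m, y, z] := by
    intro j y z
    conv_lhs => rw [hTe j]
    change slot1 Ω y z _ = _
    rw [map_sum]
    refine Finset.sum_congr rfl fun m _ => ?_
    rw [map_smul, smul_eq_mul]; rfl
  refine ⟨?_, ?_, ?_, ?_⟩
  · rw [hTT]
    apply mul_right_cancel₀ (pow_ne_zero 2 hE)
    rw [zero_mul, Finset.sum_mul, ← p1]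
    exact Finset.sum_congr rfl fun m _ => by ring
  · rw [hTT, hTT]
    apply mul_right_cancel₀ (pow_ne_zero 2 hE)
    rw [Finset.sum_mul, Finset.sum_mul]
    refine Eq.trans ?_ (p2.trans ?_)
    · exact Finset.sum_congr rfl fun m _ => by ring
    · exact Finset.sum_congr rfl fun m _ => by ring
  · rw [hO1]
    apply mul_right_cancel₀ hE
    rw [zero_mul, Finset.sum_mul, ← p3]
    exact Finset.sum_congr rfl fun m _ => by ring
  · rw [alt3_swap12 Ω (T (e 1)), hO1, hO1]
    apply mul_right_cancel₀ hE
    rw [neg_mul, Finset.sum_mul, Finset.sum_mul, ← Finset.sum_neg_distrib]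
    refine Eq.trans ?_ (p4.trans ?_)
    · exact Finset.sum_congr rfl fun m _ => by ring
    · exact Finset.sum_congr rfl fun m _ => by rw [alt3_swap12 Ω (e m)]; ring

theorem T_facts (ε : AlternatingMap ℝ W ℝ (Fin 6)) (hε : ε ≠ 0) (T : W →ₗ[ℝ] W)
    (Ω : AlternatingMap ℝ W ℝ (Fin 3))
    (hT : ∀ (θ : W →ₗ[ℝ] ℝ) (v : W),
      wedge (oneForm θ) (wedge (Ω.curryLeft v) Ω) = θ (T v) • ε)
    (e : Module.Basis (Fin 6) ℝ W) :
    (∀ v, T (T v) = e.coord 0 (T (T (e 0))) • v) ∧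
    (∀ u v w, Ω ![T u, v, w] = Ω ![u, T v, w]) := by
  have hb : ∀ i j, i ≠ j → e.coord i (T (T (e j))) = 0 ∧
      e.coord i (T (T (e i))) = e.coord j (T (T (e j))) ∧ Ω ![T (e i), e j, e i] = 0 := by
    intro i j hij
    obtain ⟨σ, rfl, rfl⟩ := perm_pair i j hij
    obtain ⟨q1, q2, q3, -⟩ := basis_facts ε hε T Ω hT (e.reindex σ.symm)
    simp only [Module.Basis.coe_reindex, Function.comp, Equiv.symm_symm,
      Module.Basis.coord_apply, Module.Basis.repr_reindex_apply] at q1 q2 q3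
    exact ⟨q1, q2, q3⟩
  have ht : ∀ i j k, i ≠ j → i ≠ k → j ≠ k → Ω ![T (e i), e j, e k] = Ω ![e i, T (e j), e k] := by
    intro i j k h1 h2 h3
    obtain ⟨σ, rfl, rfl, rfl⟩ := perm_triple i j k h1 h2 h3
    obtain ⟨-, -, -, q⟩ := basis_facts ε hε T Ω hT (e.reindex σ.symm)
    simpa using q
  constructor
  · intro v
    have : T ∘ₗ T = (e.coord 0 (T (T (e 0)))) • LinearMap.id := by
      refine e.ext fun j => ?_
      apply e.ext_elem
      intro i
      have h0 : e.coord 0 (T (T (e 0))) = e.coord j (T (T (e j))) := by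
        by_cases h : 0 = j
        · rw [h]
        · exact (hb 0 j h).2.1
      rw [h0]
      by_cases h : i = j
      · subst h; simp
      · have := (hb i j h).1
        rw [Module.Basis.coord_apply] at this
        simp [this, Finsupp.single_apply, Ne.symm h]
    exact LinearMap.congr_fun this v
  · have z1 : ∀ x y, Ω ![x, x, y] = 0 := fun x y => by linarith [alt3_swap12 Ω x x y]
    have z2 : ∀ x y, Ω ![y, x, x] = 0 := fun x y => by linarith [alt3_swap23 Ω y x x]
    have z3 : ∀ x y, Ω ![x, y, x] = 0 := fun x y => by
      rw [alt3_swap12, z2, neg_zero]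
    have hijk : ∀ i j k, Ω ![T (e i), e j, e k] = Ω ![e i, T (e j), e k] := by
      intro i j k
      by_cases hij : i = j
      · subst hij
        by_cases hik : i = k
        · subst hik; rw [z2, z3]
        · have := (hb i k hik).2.2
          rw [alt3_swap23] at this
          rw [alt3_swap12 Ω (T (e i))]
          linarith
      · by_cases hik : i = k
        · subst hik; rw [z3, (hb i j hij).2.2]
        · by_cases hjk : j = k
          · subst hjk; rw [z2, alt3_swap12, (hb j i (Ne.symm hij)).2.2, neg_zero]
          · exact ht i j k hij hik hjk
    have hml : Ω.toMultilinearMap.compLinearMap ![T, LinearMap.id, LinearMap.id] =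
        Ω.toMultilinearMap.compLinearMap ![LinearMap.id, T, LinearMap.id] := by
      refine Module.Basis.ext_multilinear (fun _ => e) fun v => ?_
      convert hijk (v 0) (v 1) (v 2) using 1 <;>
      · simp only [MultilinearMap.compLinearMap_apply, AlternatingMap.coe_multilinearMap]
        change Ω _ = Ω _
        congr 1; funext i; fin_cases i <;> rfl
    intro u v w
    have := congrArg (fun f => f ![u, v, w]) hml
    simp only [MultilinearMap.compLinearMap_apply] at this
    convert this using 1 <;>
    · change Ω _ = Ω _
      congr 1; funext i; fin_cases i <;> rfl

end geom

section cplx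
variable {W : Type*} [AddCommGroup W] [Module ℝ W]

theorem dec_apply (ξ₁ ξ₂ ξ₃ : W →ₗ[ℝ] ℂ) (x y z : W) :
    wedge (oneForm ξ₁) (wedge (oneForm ξ₂) (oneForm ξ₃)) ![x, y, z] =
      ξ₁ x * (ξ₂ y * ξ₃ z - ξ₂ z * ξ₃ y) - ξ₁ y * (ξ₂ x * ξ₃ z - ξ₂ z * ξ₃ x)
        - ξ₁ z * (ξ₂ y * ξ₃ x - ξ₂ x * ξ₃ y) := by
  have h1 := wedge12 (oneForm ξ₁) (wedge (oneForm ξ₂) (oneForm ξ₃)) ![x, y, z]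
  have h2 : ∀ a b : W, (wedge (oneForm ξ₂) (oneForm ξ₃)) ![a, b] = ξ₂ a * ξ₃ b - ξ₂ b * ξ₃ a :=
    fun a b => wedge11 (oneForm ξ₂) (oneForm ξ₃) ![a, b]
  refine h1.trans ?_
  erw [h2, h2, h2]
  rfl

theorem ext3 {A : Type*} [AddCommGroup A] [Module ℝ A] (e : Module.Basis (Fin 6) ℝ W)
    (f g : AlternatingMap ℝ W A (Fin 3))
    (h : ∀ i j k, i < j → j < k → f ![e i, e j, e k] = g ![e i, e j, e k]) : f = g := by
  refine Module.Basis.ext_alternating e fun v hv => ?_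
  have hm := Tuple.monotone_sort v
  set σ := Tuple.sort v
  have hs : StrictMono (v ∘ σ) := hm.strictMono_of_injective (hv.comp σ.injective)
  have h3 := h (v (σ 0)) (v (σ 1)) (v (σ 2)) (hs (by decide : (0 : Fin 3) < 1))
    (hs (by decide : (1 : Fin 3) < 2))
  have hv' : ![e (v (σ 0)), e (v (σ 1)), e (v (σ 2))] = (fun i => e (v i)) ∘ σ := by
    funext i; fin_cases i <;> rfl
  rw [hv', AlternatingMap.map_perm, AlternatingMap.map_perm] at h3
  exact (smul_left_cancel_iff _).1 h3

/-- The values of the three covectors of `α` on a basis. -/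
structure Tab (e : Fin 6 → W) (c : ℂ) (ξ₁ ξ₂ ξ₃ : W →ₗ[ℝ] ℂ) : Prop where
  t1 : ∀ i, ξ₁ (e i) = ![c, 0, 0, c * Complex.I, 0, 0] i
  t2 : ∀ i, ξ₂ (e i) = ![0, 1, 0, 0, Complex.I, 0] i
  t3 : ∀ i, ξ₃ (e i) = ![0, 0, 1, 0, 0, Complex.I] i

/-- `α` is given by the determinant of the covectors. -/
def IsDet (α : AlternatingMap ℝ W ℂ (Fin 3)) (ξ₁ ξ₂ ξ₃ : W →ₗ[ℝ] ℂ) : Prop :=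
  ∀ x y z, α ![x, y, z] =
      ξ₁ x * (ξ₂ y * ξ₃ z - ξ₂ z * ξ₃ y) - ξ₁ y * (ξ₂ x * ξ₃ z - ξ₂ z * ξ₃ x)
        - ξ₁ z * (ξ₂ y * ξ₃ x - ξ₂ x * ξ₃ y)

theorem conj_apply3 (α : AlternatingMap ℝ W ℂ (Fin 3)) (x y z : W) :
    conjForm α ![x, y, z] = (starRingEnd ℂ) (α ![x, y, z]) := rfl

theorem Tab.wedge_ne {e : Module.Basis (Fin 6) ℝ W} {c : ℂ} {ξ₁ ξ₂ ξ₃ : W →ₗ[ℝ] ℂ}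
    (h : Tab e c ξ₁ ξ₂ ξ₃) (hc : c ≠ 0) (α : AlternatingMap ℝ W ℂ (Fin 3))
    (hα : IsDet α ξ₁ ξ₂ ξ₃) : wedge α (conjForm α) ≠ 0 := by
  intro h0
  have h33 := wedge33 α (conjForm α) (fun i : Fin 6 => e i)
  rw [h0] at h33
  simp only [conj_apply3, hα _ _ _, h.t1, h.t2, h.t3, AlternatingMap.zero_apply,
    Matrix.cons_val] at h33
  simp at h33
  ring_nf at h33
  have h8 : c * (starRingEnd ℂ) c * Complex.I * 8 = 0 := by
    linear_combination -h33 + 4 * c * (starRingEnd ℂ) c * Complex.I * Complex.I_sq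
  simp [hc] at h8

theorem Tab.vanish {e : Module.Basis (Fin 6) ℝ W} {ξ₁ ξ₂ ξ₃ : W →ₗ[ℝ] ℂ}
    (α : AlternatingMap ℝ W ℂ (Fin 3))
    (hα : IsDet α ξ₁ ξ₂ ξ₃) (m : Fin 6) (h1 : ξ₁ (e m) = 0) (h2 : ξ₂ (e m) = 0)
    (h3 : ξ₃ (e m) = 0) : wedge α (conjForm α) (fun i : Fin 6 => e i) = 0 := by
  rw [wedge33 α (conjForm α) (fun i : Fin 6 => e i)]
  fin_cases m <;> simp at h1 h2 h3 <;>
  · simp only [conj_apply3, hα _ _ _, h1, h2, h3]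
    simp

end cplx

section main
variable {W : Type*} [AddCommGroup W] [Module ℝ W]

theorem trace_of_sq [FiniteDimensional ℝ W] (hdim : Module.finrank ℝ W = 6) (T : W →ₗ[ℝ] W)
    (c : ℝ) (h : ∀ v, T (T v) = c • v) :
    (6 : ℝ)⁻¹ * LinearMap.trace ℝ W (T ∘ₗ T) = c := by
  have : T ∘ₗ T = c • LinearMap.id := LinearMap.ext h
  rw [this, map_smul, LinearMap.trace_id, hdim, smul_eq_mul]
  push_cast; ring

theorem reverse_core (ε : AlternatingMap ℝ W ℝ (Fin 6)) (hε : ε ≠ 0) (T : W →ₗ[ℝ] W)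
    (Ω : AlternatingMap ℝ W ℝ (Fin 3))
    (hT : ∀ (θ : W →ₗ[ℝ] ℝ) (v : W),
      wedge (oneForm θ) (wedge (Ω.curryLeft v) Ω) = θ (T v) • ε)
    (e : Module.Basis (Fin 6) ℝ W) (ξ₁ ξ₂ ξ₃ : W →ₗ[ℝ] ℂ) (htab : Tab e 1 ξ₁ ξ₂ ξ₃)
    (α : AlternatingMap ℝ W ℂ (Fin 3)) (hα : IsDet α ξ₁ ξ₂ ξ₃) (hΩ : cx Ω = α + conjForm α) :
    e.coord 0 (T (T (e 0))) < 0 := by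
  have hE : ε e ≠ 0 := (ε.map_basis_ne_zero_iff e).2 hε
  have hTe : ∀ j, T (e j) = ∑ m, e.coord m (T (e j)) • e m := fun j => by
    simpa using (e.sum_repr (T (e j))).symm
  have hTT : e.coord 0 (T (T (e 0))) =
      ∑ m, e.coord 0 (T (e m)) * e.coord m (T (e 0)) := by
    conv_lhs => rw [hTe 0]
    rw [map_sum, map_sum]
    refine Finset.sum_congr rfl fun m _ => ?_
    rw [map_smul, map_smul, smul_eq_mul, mul_comm]
  have hc := coord_formula ε T Ω hT e
  have hO : ∀ a b c, Ω ![e a, e b, e c] = 2 * (α ![e a, e b, e c]).re := by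
    intro a b c
    have h := congrArg (fun f => (f ![e a, e b, e c]).re) hΩ
    have h' : ((cx Ω) ![e a, e b, e c]).re = Ω ![e a, e b, e c] := rfl
    simp only [AlternatingMap.add_apply, conj_apply3, Complex.add_re, Complex.conj_re] at h
    linarith
  have hP : (e.coord 0 (T (T (e 0)))) * (ε e) ^ 2 =
      ∑ m, Pm (fun a b c => Ω ![e a, e b, e c]) 0 m *
        Pm (fun a b c => Ω ![e a, e b, e c]) m 0 := by
    rw [hTT, Finset.sum_mul]
    refine Finset.sum_congr rfl fun m _ => ?_
    rw [← hc, ← hc]; ring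
  have hval : ∑ m, Pm (fun a b c => Ω ![e a, e b, e c]) 0 m *
        Pm (fun a b c => Ω ![e a, e b, e c]) m 0 < 0 := by
    simp only [Fin.sum_univ_six, Pm, Bq, Matrix.cons_val, hO, hα _ _ _, htab.t1, htab.t2, htab.t3]
    simp
    norm_num
  rw [← hP] at hval
  have : 0 < (ε e) ^ 2 := by positivity
  by_contra hn
  push Not at hn
  nlinarith [mul_nonneg hn this.le]

theorem six_zero (e : Module.Basis (Fin 6) ℝ W) (f : AlternatingMap ℝ W ℂ (Fin 6))
    (hz : f (fun i => e i) = 0) : f = 0 := by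
  refine Module.Basis.ext_alternating e fun s hs => ?_
  let σ : Equiv.Perm (Fin 6) := Equiv.ofBijective s (Finite.injective_iff_bijective.1 hs)
  have := AlternatingMap.map_perm f (fun i : Fin 6 => e i) σ
  rw [hz, smul_zero] at this
  exact this

theorem reverse_basis (hdim : Module.finrank ℝ W = 6) [FiniteDimensional ℝ W]
    (ξ₁ ξ₂ ξ₃ : W →ₗ[ℝ] ℂ)
    (α : AlternatingMap ℝ W ℂ (Fin 3)) (hα : IsDet α ξ₁ ξ₂ ξ₃)
    (hne : wedge α (conjForm α) ≠ 0) :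
    ∃ e : Module.Basis (Fin 6) ℝ W, Tab e 1 ξ₁ ξ₂ ξ₃ := by
  let L : W →ₗ[ℝ] (Fin 6 → ℝ) := LinearMap.pi
    ![Complex.reLm ∘ₗ ξ₁, Complex.reLm ∘ₗ ξ₂, Complex.reLm ∘ₗ ξ₃,
      Complex.imLm ∘ₗ ξ₁, Complex.imLm ∘ₗ ξ₂, Complex.imLm ∘ₗ ξ₃]
  have hinj : Function.Injective L := by
    rw [← LinearMap.ker_eq_bot, LinearMap.ker_eq_bot']
    intro v hv
    by_contra hv0
    apply hne
    have hL : ∀ i, L v i = 0 := fun i => by rw [hv]; rfl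
    have h1 : ξ₁ v = 0 := Complex.ext (hL 0) (hL 3)
    have h2 : ξ₂ v = 0 := Complex.ext (hL 1) (hL 4)
    have h3 : ξ₃ v = 0 := Complex.ext (hL 2) (hL 5)
    have hli : LinearIndepOn ℝ id ({v} : Set W) := LinearIndepOn.singleton hv0
    let b := Module.Basis.extend hli
    have : Fintype (hli.extend (Set.subset_univ _)) := FiniteDimensional.fintypeBasisIndex b
    have hcard : Fintype.card (hli.extend (Set.subset_univ _)) = 6 := by
      rw [← Module.finrank_eq_card_basis b, hdim]
    let e := b.reindex (Fintype.equivFinOfCardEq hcard)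
    have hmem : v ∈ hli.extend (Set.subset_univ _) :=
      hli.subset_extend _ (Set.mem_singleton v)
    have hem : e (Fintype.equivFinOfCardEq hcard ⟨v, hmem⟩) = v := by
      simp [e, b]
    have hz := Tab.vanish (e := e) α hα (Fintype.equivFinOfCardEq hcard ⟨v, hmem⟩)
      (by rw [hem, h1]) (by rw [hem, h2]) (by rw [hem, h3])
    exact six_zero e (wedge α (conjForm α)) hz
  have hfr : Module.finrank ℝ W = Module.finrank ℝ (Fin 6 → ℝ) := by rw [hdim]; simp
  let Le := LinearEquiv.ofInjectiveOfFinrankEq L hinj hfr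
  let e := Module.Basis.ofEquivFun Le
  have he : ∀ i, L (e i) = Pi.single i 1 := by
    intro i
    have : Le (e i) = Pi.single i 1 := by simp [e]
    exact this
  have hval : ∀ i j, L (e i) j = (Pi.single i 1 : Fin 6 → ℝ) j := fun i j => by rw [he]
  refine ⟨e, ?_, ?_, ?_⟩
  · intro i
    have hr : (ξ₁ (e i)).re = _ := hval i 0
    have hi : (ξ₁ (e i)).im = _ := hval i 3
    apply Complex.ext
    · rw [hr]; fin_cases i <;> simp
    · rw [hi]; fin_cases i <;> simp
  · intro i
    have hr : (ξ₂ (e i)).re = _ := hval i 1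
    have hi : (ξ₂ (e i)).im = _ := hval i 4
    apply Complex.ext
    · rw [hr]; fin_cases i <;> simp
    · rw [hi]; fin_cases i <;> simp
  · intro i
    have hr : (ξ₃ (e i)).re = _ := hval i 2
    have hi : (ξ₃ (e i)).im = _ := hval i 5
    apply Complex.ext
    · rw [hr]; fin_cases i <;> simp
    · rw [hi]; fin_cases i <;> simp

end main

section fwd
variable {W : Type*} [AddCommGroup W] [Module ℝ W]

/-- Compatibility of a complex structure with a 3-form. -/
structure Compat (J : W →ₗ[ℝ] W) (Ω : AlternatingMap ℝ W ℝ (Fin 3)) : Prop where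
  sq : ∀ v, J (J v) = - v
  mv : ∀ u v w, Ω ![J u, v, w] = Ω ![u, J v, w]

namespace Compat
variable {J : W →ₗ[ℝ] W} {Ω : AlternatingMap ℝ W ℝ (Fin 3)}

theorem m2 (h : Compat J Ω) (u v w : W) : Ω ![u, J v, w] = Ω ![J u, v, w] := (h.mv u v w).symm

theorem m3 (h : Compat J Ω) (u v w : W) : Ω ![u, v, J w] = Ω ![J u, v, w] := by
  rw [alt3_swap23 Ω u (J w) v, h.m2, alt3_swap23 Ω (J u) v w, neg_neg]

end Compat

theorem alt3_neg1 (Ω : AlternatingMap ℝ W ℝ (Fin 3)) (u v w : W) :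
    Ω ![-u, v, w] = - Ω ![u, v, w] := map_neg (slot1 Ω v w) u

theorem alt3_z12 (Ω : AlternatingMap ℝ W ℝ (Fin 3)) (u w : W) : Ω ![u, u, w] = 0 := by
  linarith [alt3_swap12 Ω u u w]

theorem alt3_z23 (Ω : AlternatingMap ℝ W ℝ (Fin 3)) (u w : W) : Ω ![w, u, u] = 0 := by
  linarith [alt3_swap23 Ω w u u]

theorem alt3_z13 (Ω : AlternatingMap ℝ W ℝ (Fin 3)) (u w : W) : Ω ![u, w, u] = 0 := by
  rw [alt3_swap12, alt3_z23, neg_zero]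

theorem Compat.zJ12 {J : W →ₗ[ℝ] W} {Ω : AlternatingMap ℝ W ℝ (Fin 3)} (h : Compat J Ω)
    (u w : W) : Ω ![J u, u, w] = 0 := by
  linarith [alt3_swap12 Ω (J u) u w, h.mv u u w]

theorem Compat.zJ13 {J : W →ₗ[ℝ] W} {Ω : AlternatingMap ℝ W ℝ (Fin 3)} (h : Compat J Ω)
    (u w : W) : Ω ![J u, w, u] = 0 := by
  rw [alt3_swap23, h.zJ12, neg_zero]

theorem Compat.indep1 {J : W →ₗ[ℝ] W} {Ω : AlternatingMap ℝ W ℝ (Fin 3)} (h : Compat J Ω)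
    {x y z : W} (hp : Ω ![x, y, z] ≠ 0) {a b c a' b' c' : ℝ}
    (h0 : a • x + b • y + c • z + a' • J x + b' • J y + c' • J z = 0) : a = 0 ∧ a' = 0 := by
  have e1 := congrArg (slot1 Ω y z) h0
  have e2 := congrArg (fun w => slot1 Ω y z (J w)) h0
  simp only [map_add, map_smul, h.sq, map_neg, map_zero] at e1 e2
  have s : ∀ u, slot1 Ω y z u = Ω ![u, y, z] := fun _ => rfl
  simp only [s, alt3_z12, alt3_z13, h.zJ12, h.zJ13, smul_eq_mul] at e1 e2
  set p := Ω ![x, y, z]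
  set q := Ω ![J x, y, z]
  have hpq : p ^ 2 + q ^ 2 ≠ 0 := by positivity
  have f1 : a * (p ^ 2 + q ^ 2) = 0 := by linear_combination p * e1 + q * e2
  have f2 : a' * (p ^ 2 + q ^ 2) = 0 := by linear_combination q * e1 - p * e2
  exact ⟨(mul_eq_zero.1 f1).resolve_right hpq, (mul_eq_zero.1 f2).resolve_right hpq⟩

theorem Compat.basis {J : W →ₗ[ℝ] W} {Ω : AlternatingMap ℝ W ℝ (Fin 3)} (h : Compat J Ω)
    [FiniteDimensional ℝ W] (hdim : Module.finrank ℝ W = 6)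
    {x y z : W} (hp : Ω ![x, y, z] ≠ 0) :
    ∃ e : Module.Basis (Fin 6) ℝ W, ∀ i, e i = ![x, y, z, J x, J y, J z] i := by
  have hli : LinearIndependent ℝ ![x, y, z, J x, J y, J z] := by
    rw [Fintype.linearIndependent_iff]
    intro g hg
    simp only [Fin.sum_univ_six, Matrix.cons_val] at hg
    have hy : Ω ![y, z, x] ≠ 0 := by
      rw [alt3_swap23, alt3_swap12, neg_neg]; exact hp
    have hz : Ω ![z, x, y] ≠ 0 := by
      rw [alt3_swap12, alt3_swap23, neg_neg]; exact hp
    have r1 := h.indep1 hp hg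
    have r2 := h.indep1 hy (a := g 1) (b := g 2) (c := g 0) (a' := g 4) (b' := g 5) (c' := g 3)
      (by rw [← hg]; abel)
    have r3 := h.indep1 hz (a := g 2) (b := g 0) (c := g 1) (a' := g 5) (b' := g 3) (c' := g 4)
      (by rw [← hg]; abel)
    intro i
    fin_cases i
    exacts [r1.1, r2.1, r3.1, r1.2, r2.2, r3.2]
  refine ⟨basisOfLinearIndependentOfCardEqFinrank hli (by rw [hdim]; simp), fun i => by simp⟩

theorem Compat.forward {J : W →ₗ[ℝ] W} {Ω : AlternatingMap ℝ W ℝ (Fin 3)} (h : Compat J Ω)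
    [FiniteDimensional ℝ W] (hdim : Module.finrank ℝ W = 6) (hΩ : Ω ≠ 0) :
    ∃ α : AlternatingMap ℝ W ℂ (Fin 3),
        IsDecomposable α ∧ wedge α (conjForm α) ≠ 0 ∧ cx Ω = α + conjForm α := by
  have hex : ∃ x y z, Ω ![x, y, z] ≠ 0 := by
    by_contra hn
    push Not at hn
    apply hΩ
    ext v
    have hv : v = ![v 0, v 1, v 2] := by funext i; fin_cases i <;> rfl
    rw [hv, hn]; rfl
  obtain ⟨x, y, z, hp⟩ := hex
  obtain ⟨e, he⟩ := h.basis hdim hp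
  let κ : Fin 6 → W →ₗ[ℝ] ℂ := fun i => (Algebra.linearMap ℝ ℂ) ∘ₗ e.coord i
  have hκ : ∀ i j, κ i (e j) = if j = i then 1 else 0 := by
    intro i j
    simp only [κ, LinearMap.comp_apply, Module.Basis.coord_apply, Module.Basis.repr_self,
      Finsupp.single_apply, Algebra.linearMap_apply]
    split_ifs <;> simp
  set p := Ω ![x, y, z] with hpdef
  set q := Ω ![J x, y, z] with hqdef
  let c : ℂ := ((p : ℂ) - q * Complex.I) / 2
  have hcre : c.re = p / 2 := by simp [c]
  have hcim : c.im = - q / 2 := by simp [c]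
  have hc : c ≠ 0 := by
    intro h0
    rw [h0] at hcre
    apply hp
    rw [Complex.zero_re] at hcre
    linarith
  let ξ₁ := c • (κ 0 + Complex.I • κ 3)
  let ξ₂ := κ 1 + Complex.I • κ 4
  let ξ₃ := κ 2 + Complex.I • κ 5
  have htab : Tab e c ξ₁ ξ₂ ξ₃ := by
    refine ⟨?_, ?_, ?_⟩ <;> intro i <;>
      simp only [ξ₁, ξ₂, ξ₃, LinearMap.add_apply, LinearMap.smul_apply, hκ] <;>
      fin_cases i <;> simp
  let α : AlternatingMap ℝ W ℂ (Fin 3) := wedge (oneForm ξ₁) (wedge (oneForm ξ₂) (oneForm ξ₃))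
  have hα : IsDet α ξ₁ ξ₂ ξ₃ := dec_apply ξ₁ ξ₂ ξ₃
  refine ⟨α, ⟨ξ₁, ξ₂, ξ₃, rfl⟩, htab.wedge_ne hc α hα, ?_⟩
  have hO : ∀ i j k, i < j → j < k →
      Ω ![e i, e j, e k] = 2 * (α ![e i, e j, e k]).re := by
    intro i j k hij hjk
    simp only [hα _ _ _, htab.t1, htab.t2, htab.t3]
    have p1 : Ω ![y, x, z] = -p := alt3_swap12 _ _ _ _
    have p2 : Ω ![x, z, y] = -p := alt3_swap23 _ _ _ _
    have p3 : Ω ![y, z, x] = p := by rw [alt3_swap23, p1, neg_neg]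
    have p4 : Ω ![z, x, y] = p := by rw [alt3_swap12, p2, neg_neg]
    have p5 : Ω ![z, y, x] = -p := by rw [alt3_swap12, p3]
    have q2 : Ω ![J x, z, y] = -q := alt3_swap23 _ _ _ _
    have q1 : Ω ![J y, x, z] = -q := by rw [h.mv, alt3_swap12]
    have q3 : Ω ![J y, z, x] = q := by rw [alt3_swap23, q1, neg_neg]
    have q4 : Ω ![J z, x, y] = q := by rw [h.mv, alt3_swap12, q2, neg_neg]
    have q5 : Ω ![J z, y, x] = -q := by rw [alt3_swap23, q4]
    have he0 : e 0 = x := he 0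
    have he1 : e 1 = y := he 1
    have he2 : e 2 = z := he 2
    have he3 : e 3 = J x := he 3
    have he4 : e 4 = J y := he 4
    have he5 : e 5 = J z := he 5
    fin_cases i <;> fin_cases j <;> (try (exact absurd hij (by decide))) <;> fin_cases k <;>
      (try (exact absurd hjk (by decide))) <;>
      simp [he0, he1, he2, he3, he4, he5, h.m2, h.m3, h.sq, alt3_neg1, alt3_z12, alt3_z13,
        alt3_z23, h.zJ12, h.zJ13, p1, p2, p3, p4, p5, q1, q2, q3, q4, q5, hcre, hcim,
        ← hpdef, ← hqdef] <;> ring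
  refine ext3 e _ _ fun i j k hij hjk => ?_
  have h1 : (cx Ω) ![e i, e j, e k] = ((Ω ![e i, e j, e k] : ℝ) : ℂ) := rfl
  rw [h1, hO i j k hij hjk, AlternatingMap.add_apply, conj_apply3, Complex.add_conj]

end fwd

/-- For `Ω ∈ Λ³W*` (W a 6-dimensional real vector space),
`λ(Ω) < 0` iff `Ω = α + ᾱ` for a decomposable complex 3-form `α` on `W ⊗ ℂ`
with `α ∧ ᾱ ≠ 0` (complex 3-forms on `W ⊗ ℂ` being identified with their
restrictions to `W`, which are `ℂ`-valued `ℝ`-alternating forms). -/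
theorem stmt5 (W : Type*) [AddCommGroup W] [Module ℝ W] [FiniteDimensional ℝ W]
    (hdim : Module.finrank ℝ W = 6)
    (ε : AlternatingMap ℝ W ℝ (Fin 6)) (hε : ε ≠ 0)
    (K : AlternatingMap ℝ W ℝ (Fin 3) → W →ₗ[ℝ] W)
    (hK : ∀ (Ω : AlternatingMap ℝ W ℝ (Fin 3)) (θ : W →ₗ[ℝ] ℝ) (v : W),
      wedge (oneForm θ) (wedge (Ω.curryLeft v) Ω) = θ (K Ω v) • ε)
    (Ω : AlternatingMap ℝ W ℝ (Fin 3)) :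
    (6 : ℝ)⁻¹ * LinearMap.trace ℝ W (K Ω ∘ₗ K Ω) < 0 ↔
      ∃ α : AlternatingMap ℝ W ℂ (Fin 3),
        IsDecomposable α ∧ wedge α (conjForm α) ≠ 0 ∧ cx Ω = α + conjForm α := by
  constructor
  · intro hlam
    let e := Module.finBasisOfFinrankEq ℝ W hdim
    obtain ⟨hsq, hmv⟩ := T_facts ε hε (K Ω) Ω (hK Ω) e
    set c := e.coord 0 (K Ω (K Ω (e 0))) with hcdef
    rw [trace_of_sq hdim (K Ω) c hsq] at hlam
    have hs : 0 < Real.sqrt (-c) := Real.sqrt_pos.2 (by linarith)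
    have hs2 : Real.sqrt (-c) * Real.sqrt (-c) = -c := Real.mul_self_sqrt (by linarith)
    have hcomp : Compat ((Real.sqrt (-c))⁻¹ • K Ω) Ω := by
      refine ⟨fun v => ?_, fun u v w => ?_⟩
      · simp only [LinearMap.smul_apply, map_smul, hsq, smul_smul]
        have : (Real.sqrt (-c))⁻¹ * ((Real.sqrt (-c))⁻¹ * c) = -1 := by
          field_simp
          linarith [hs2]
        rw [← mul_assoc] at this
        simp only [← mul_assoc, this, neg_smul, one_smul]
      · simp only [LinearMap.smul_apply]
        rw [alt3_smul1, hmv, alt3_swap12 Ω (K Ω v) u w,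
          alt3_swap12 Ω (_ • K Ω v) u w, alt3_smul1]
        simp
    refine hcomp.forward hdim ?_
    rintro rfl
    have h0 := (coord_formula ε (K 0) 0 (hK 0) e)
    have hE : ε e ≠ 0 := (ε.map_basis_ne_zero_iff e).2 hε
    have hz : ∀ i j, e.coord i (K 0 (e j)) = 0 := by
      intro i j
      have := h0 i j
      have hP : Pm (fun a b c => (0 : AlternatingMap ℝ W ℝ (Fin 3)) ![e a, e b, e c]) i j = 0 := by
        fin_cases i <;> simp [Pm, Bq]
      rw [hP] at this
      exact (mul_eq_zero.1 this).resolve_right hE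
    have hK0 : K 0 (e 0) = 0 := by
      apply e.ext_elem
      intro i
      simpa using hz i 0
    rw [hK0] at hcdef
    simp at hcdef
    linarith
  · rintro ⟨α, ⟨ξ₁, ξ₂, ξ₃, hα⟩, hne, hΩ⟩
    have hdet : IsDet α ξ₁ ξ₂ ξ₃ := by
      rw [hα]; exact dec_apply ξ₁ ξ₂ ξ₃
    obtain ⟨e, htab⟩ := reverse_basis hdim ξ₁ ξ₂ ξ₃ α hdet hne
    obtain ⟨hsq, -⟩ := T_facts ε hε (K Ω) Ω (hK Ω) e
    rw [trace_of_sq hdim (K Ω) _ hsq]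
    exact reverse_core ε hε (K Ω) Ω (hK Ω) e ξ₁ ξ₂ ξ₃ htab α hdet hΩ
end
end

section
/- If Ω ∈ Λ³W* satisfies λ(Ω) < 0, then the endomorphism I_Ω = (−λ(Ω))^{−1/2}·K_Ω of W satisfies I_Ω ∘ I_Ω = −id_W; thus I_Ω is a complex structure on W. -/
open scoped TensorProduct

noncomputable section

open Equiv in
lemma wedge_sum {M : Type*} [AddCommGroup M] [Module ℝ M] {m n : ℕ}
    (α : AlternatingMap ℝ M ℝ (Fin m)) (β : AlternatingMap ℝ M ℝ (Fin n)) (v : Fin (m + n) → M) :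
    ((m.factorial * n.factorial : ℕ) : ℝ) * wedge α β v =
      ∑ σ : Perm (Fin (m + n)), (((Perm.sign σ : ℤˣ) : ℤ) : ℝ) *
        (α (fun i => v (σ (Fin.castAdd n i))) * β (fun j => v (σ (Fin.natAdd m j)))) := by
  have h := MultilinearMap.domCoprod_alternization_eq α β
  have h2 := congrArg (fun F => LinearMap.mul' ℝ ℝ (F (v ∘ finSumFinEquiv))) h
  simp only [MultilinearMap.alternatization_apply, Fintype.card_fin, AlternatingMap.smul_apply,
    map_sum, map_nsmul] at h2
  have h3 : LinearMap.mul' ℝ ℝ (α.domCoprod β (v ∘ finSumFinEquiv)) = wedge α β v := rfl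
  rw [h3, nsmul_eq_mul] at h2
  rw [← h2]
  refine Fintype.sum_equiv (Equiv.permCongr finSumFinEquiv) _ _ ?_
  intro σ
  rw [Units.smul_def, map_zsmul, zsmul_eq_mul]
  simp [Perm.sign_permCongr, MultilinearMap.domDomCongr_apply]

open Equiv in
lemma sign_swap_real {n : ℕ} (p : Fin (n+1)) : (((Perm.sign (swap 0 p) : ℤˣ) : ℤ) : ℝ) = if p = 0 then 1 else -1 := by
  split_ifs with h
  · simp [h]
  · rw [Perm.sign_swap (Ne.symm h)]; simp

open Equiv in
lemma dec_apply_succ {n : ℕ} (p : Fin (n+1)) (e : Perm (Fin n)) (i : Fin n) :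
    Perm.decomposeFin.symm (p, e) i.succ = swap 0 p (e i).succ := by simp

open Equiv in
lemma wedge_one_five {M : Type*} [AddCommGroup M] [Module ℝ M]
    (θ : M →ₗ[ℝ] ℝ) (β : AlternatingMap ℝ M ℝ (Fin 5)) (v : Fin 6 → M) :
    wedge (oneForm θ) β v =
      ∑ p : Fin 6, (if p = 0 then 1 else -1) *
        (θ (v p) * β (fun j => v (swap 0 p j.succ))) := by
  have h := wedge_sum (oneForm θ) β v
  have key : ∀ σ : Perm (Fin 6), (((Perm.sign σ : ℤˣ) : ℤ) : ℝ) *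
        (oneForm θ (fun i => v (σ (Fin.castAdd 5 i))) * β (fun j => v (σ (Fin.natAdd 1 j))))
      = (((Perm.sign σ : ℤˣ) : ℤ) : ℝ) *
        (θ (v (σ 0)) * β (fun j => v (σ j.succ))) := by
    intro σ
    have : ∀ j : Fin 5, (Fin.natAdd 1 j) = j.succ := by decide
    simp only [this]
    rfl
  have h' : ((Nat.factorial 1 * Nat.factorial 5 : ℕ) : ℝ) * wedge (oneForm θ) β v = ∑ σ : Perm (Fin 6), (((Perm.sign σ : ℤˣ) : ℤ) : ℝ) *
        (θ (v (σ 0)) * β (fun j => v (σ j.succ))) :=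
    h.trans (Finset.sum_congr rfl fun σ _ => key σ)
  rw [← Equiv.sum_comp (Perm.decomposeFin (n := 5)).symm, Fintype.sum_prod_type] at h'
  have h2 : ∀ (p : Fin 6) (e : Perm (Fin 5)), (((Perm.sign (Perm.decomposeFin.symm (p, e)) : ℤˣ) : ℤ) : ℝ) *
        (θ (v (Perm.decomposeFin.symm (p, e) 0)) * β (fun j => v (Perm.decomposeFin.symm (p, e) j.succ)))
       = (if p = 0 then 1 else -1) *
        (θ (v p) * β (fun j => v (swap 0 p j.succ))) := by
    intro p e
    have h3 := β.map_perm (fun j => v (swap 0 p j.succ)) e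
    simp only [dec_apply_succ, Perm.decomposeFin_symm_apply_zero, Perm.decomposeFin.symm_sign]
    have h4 : β (fun j => v (swap 0 p (e j).succ)) = _ := h3
    rw [h4, Units.smul_def]
    rcases Int.units_eq_one_or (Perm.sign e) with h5 | h5 <;> rw [h5] <;> split_ifs <;> simp
  simp only [h2] at h'
  simp only [Finset.sum_const, Finset.card_univ, Fintype.card_perm, Fintype.card_fin, nsmul_eq_mul, ← Finset.mul_sum] at h'
  refine mul_left_cancel₀ (b := wedge (oneForm θ) β v) (a := ((Nat.factorial 5 : ℕ) : ℝ)) (by positivity) ?_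
  simpa using h'

open Equiv in
lemma wedge_two_three {M : Type*} [AddCommGroup M] [Module ℝ M]
    (α : AlternatingMap ℝ M ℝ (Fin 2)) (β : AlternatingMap ℝ M ℝ (Fin 3)) (v : Fin 5 → M) :
    2 * wedge α β v =
      ∑ p : Fin 5, ∑ q : Fin 4, (if p = 0 then 1 else -1) * (if q = 0 then 1 else -1) *
        (α ![v p, v (swap 0 p q.succ)] * β (fun j => v (swap 0 p (swap 0 q j.succ).succ))) := by
  have h := wedge_sum α β v
  have key : ∀ σ : Perm (Fin 5), (((Perm.sign σ : ℤˣ) : ℤ) : ℝ) *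
        (α (fun i => v (σ (Fin.castAdd 3 i))) * β (fun j => v (σ (Fin.natAdd 2 j))))
      = (((Perm.sign σ : ℤˣ) : ℤ) : ℝ) *
        (α ![v (σ 0), v (σ (Fin.succ 0))] * β (fun j => v (σ j.succ.succ))) := by
    intro σ
    have : ∀ j : Fin 3, (Fin.natAdd 2 j) = j.succ.succ := by decide
    simp only [this]
    have h1 : (fun i => v (σ (Fin.castAdd 3 i))) = ![v (σ 0), v (σ (Fin.succ 0))] := by
      funext i; fin_cases i <;> rfl
    rw [h1]
  have h' : ((Nat.factorial 2 * Nat.factorial 3 : ℕ) : ℝ) * wedge α β v = ∑ σ : Perm (Fin 5), (((Perm.sign σ : ℤˣ) : ℤ) : ℝ) *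
        (α ![v (σ 0), v (σ (Fin.succ 0))] * β (fun j => v (σ j.succ.succ))) :=
    h.trans (Finset.sum_congr rfl fun σ _ => key σ)
  rw [← Equiv.sum_comp (Perm.decomposeFin (n := 4)).symm, Fintype.sum_prod_type] at h'
  simp only [← Equiv.sum_comp (Perm.decomposeFin (n := 3)).symm, Fintype.sum_prod_type] at h'
  have h2 : ∀ (p : Fin 5) (q : Fin 4) (e : Perm (Fin 3)),
     (((Perm.sign (Perm.decomposeFin.symm (p, Perm.decomposeFin.symm (q, e))) : ℤˣ) : ℤ) : ℝ) *
        (α ![v (Perm.decomposeFin.symm (p, Perm.decomposeFin.symm (q, e)) 0), v (Perm.decomposeFin.symm (p, Perm.decomposeFin.symm (q, e)) (Fin.succ 0))] * β (fun j => v (Perm.decomposeFin.symm (p, Perm.decomposeFin.symm (q, e)) j.succ.succ)))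
       = (if p = 0 then 1 else -1) * (if q = 0 then 1 else -1) *
        (α ![v p, v (swap 0 p q.succ)] * β (fun j => v (swap 0 p (swap 0 q j.succ).succ))) := by
    intro p q e
    have h3 := β.map_perm (fun j => v (swap 0 p (swap 0 q j.succ).succ)) e
    simp only [dec_apply_succ, Perm.decomposeFin_symm_apply_zero, Perm.decomposeFin.symm_sign]
    have h4 : β (fun j => v (swap 0 p (swap 0 q (e j).succ).succ)) = _ := h3
    rw [h4, Units.smul_def]
    rcases Int.units_eq_one_or (Perm.sign e) with h5 | h5 <;> rw [h5] <;> split_ifs <;> simp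
  simp only [h2] at h'
  simp only [Finset.sum_const, Finset.card_univ, Fintype.card_perm, Fintype.card_fin, nsmul_eq_mul, ← Finset.mul_sum] at h'
  refine mul_left_cancel₀ (b := 2 * wedge α β v) (a := ((Nat.factorial 3 : ℕ) : ℝ)) (by positivity) ?_
  rw [← h']; push_cast [Nat.factorial]; ring

open Equiv in
/-- Twice the entries of `ε(b) K` in a basis, as a function of the coefficients of `Ω`. -/
def entryT (A : Fin 6 → Fin 6 → Fin 6 → ℝ) (i j : Fin 6) : ℝ :=
  (if i = 0 then 1 else -1) * ∑ p : Fin 5, ∑ q : Fin 4,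
    (if p = 0 then 1 else -1) * (if q = 0 then 1 else -1) *
      (A j (swap 0 i p.succ) (swap 0 i (swap 0 p q.succ).succ) *
        A (swap 0 i (swap 0 p (swap 0 q (Fin.succ 0)).succ).succ)
          (swap 0 i (swap 0 p (swap 0 q (Fin.succ 1)).succ).succ)
          (swap 0 i (swap 0 p (swap 0 q (Fin.succ 2)).succ).succ))

/-- The ten term formula. -/
def tenP (A : Fin 6 → Fin 6 → Fin 6 → ℝ) (j a b c d e : Fin 6) : ℝ :=
  A j a b * A c d e - A j a c * A b d e + A j a d * A b c e - A j a e * A b c d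
  + A j b c * A a d e - A j b d * A a c e + A j b e * A a c d
  + A j c d * A a b e - A j c e * A a b d + A j d e * A a b c

open Equiv in
lemma entryT_eq (A : Fin 6 → Fin 6 → Fin 6 → ℝ) (h1 : ∀ i j k, A i j k = - A j i k)
    (h2 : ∀ i j k, A i j k = - A i k j) (i j : Fin 6) :
    entryT A i j = 2 * ((if i = 0 then 1 else -1) * tenP A j (swap 0 i 1) (swap 0 i 2)
      (swap 0 i 3) (swap 0 i 4) (swap 0 i 5)) := by
  unfold entryT tenP
  generalize (swap 0 i) = s
  simp only [Fin.sum_univ_five, Fin.sum_univ_four]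
  change (if i = 0 then 1 else -1) * ((
      (if (0 : Fin 5) = 0 then 1 else -1) * (if (0 : Fin 4) = 0 then 1 else -1) * (A j (s 1) (s 2) * A (s 3) (s 4) (s 5)) +
      (if (0 : Fin 5) = 0 then 1 else -1) * (if (1 : Fin 4) = 0 then 1 else -1) * (A j (s 1) (s 3) * A (s 2) (s 4) (s 5)) +
      (if (0 : Fin 5) = 0 then 1 else -1) * (if (2 : Fin 4) = 0 then 1 else -1) * (A j (s 1) (s 4) * A (s 3) (s 2) (s 5)) +
      (if (0 : Fin 5) = 0 then 1 else -1) * (if (3 : Fin 4) = 0 then 1 else -1) * (A j (s 1) (s 5) * A (s 3) (s 4) (s 2))) +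
    (
      (if (1 : Fin 5) = 0 then 1 else -1) * (if (0 : Fin 4) = 0 then 1 else -1) * (A j (s 2) (s 1) * A (s 3) (s 4) (s 5)) +
      (if (1 : Fin 5) = 0 then 1 else -1) * (if (1 : Fin 4) = 0 then 1 else -1) * (A j (s 2) (s 3) * A (s 1) (s 4) (s 5)) +
      (if (1 : Fin 5) = 0 then 1 else -1) * (if (2 : Fin 4) = 0 then 1 else -1) * (A j (s 2) (s 4) * A (s 3) (s 1) (s 5)) +
      (if (1 : Fin 5) = 0 then 1 else -1) * (if (3 : Fin 4) = 0 then 1 else -1) * (A j (s 2) (s 5) * A (s 3) (s 4) (s 1))) +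
    (
      (if (2 : Fin 5) = 0 then 1 else -1) * (if (0 : Fin 4) = 0 then 1 else -1) * (A j (s 3) (s 2) * A (s 1) (s 4) (s 5)) +
      (if (2 : Fin 5) = 0 then 1 else -1) * (if (1 : Fin 4) = 0 then 1 else -1) * (A j (s 3) (s 1) * A (s 2) (s 4) (s 5)) +
      (if (2 : Fin 5) = 0 then 1 else -1) * (if (2 : Fin 4) = 0 then 1 else -1) * (A j (s 3) (s 4) * A (s 1) (s 2) (s 5)) +
      (if (2 : Fin 5) = 0 then 1 else -1) * (if (3 : Fin 4) = 0 then 1 else -1) * (A j (s 3) (s 5) * A (s 1) (s 4) (s 2))) +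
    (
      (if (3 : Fin 5) = 0 then 1 else -1) * (if (0 : Fin 4) = 0 then 1 else -1) * (A j (s 4) (s 2) * A (s 3) (s 1) (s 5)) +
      (if (3 : Fin 5) = 0 then 1 else -1) * (if (1 : Fin 4) = 0 then 1 else -1) * (A j (s 4) (s 3) * A (s 2) (s 1) (s 5)) +
      (if (3 : Fin 5) = 0 then 1 else -1) * (if (2 : Fin 4) = 0 then 1 else -1) * (A j (s 4) (s 1) * A (s 3) (s 2) (s 5)) +
      (if (3 : Fin 5) = 0 then 1 else -1) * (if (3 : Fin 4) = 0 then 1 else -1) * (A j (s 4) (s 5) * A (s 3) (s 1) (s 2))) +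
    (
      (if (4 : Fin 5) = 0 then 1 else -1) * (if (0 : Fin 4) = 0 then 1 else -1) * (A j (s 5) (s 2) * A (s 3) (s 4) (s 1)) +
      (if (4 : Fin 5) = 0 then 1 else -1) * (if (1 : Fin 4) = 0 then 1 else -1) * (A j (s 5) (s 3) * A (s 2) (s 4) (s 1)) +
      (if (4 : Fin 5) = 0 then 1 else -1) * (if (2 : Fin 4) = 0 then 1 else -1) * (A j (s 5) (s 4) * A (s 3) (s 2) (s 1)) +
      (if (4 : Fin 5) = 0 then 1 else -1) * (if (3 : Fin 4) = 0 then 1 else -1) * (A j (s 5) (s 1) * A (s 3) (s 4) (s 2)))) = _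
  have n5 : (1 : Fin 5) ≠ 0 ∧ (2 : Fin 5) ≠ 0 ∧ (3 : Fin 5) ≠ 0 ∧ (4 : Fin 5) ≠ 0 := by decide
  have n4 : (1 : Fin 4) ≠ 0 ∧ (2 : Fin 4) ≠ 0 ∧ (3 : Fin 4) ≠ 0 := by decide
  obtain ⟨a1, a2, a3, a4⟩ := n5
  obtain ⟨c1, c2, c3⟩ := n4
  simp only [if_true, if_neg a1, if_neg a2, if_neg a3, if_neg a4, if_neg c1, if_neg c2, if_neg c3]
  generalize (if i = 0 then (1 : ℝ) else -1) = sg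
  generalize s 1 = x1
  generalize s 2 = x2
  generalize s 3 = x3
  generalize s 4 = x4
  generalize s 5 = x5
  have p213 : ∀ i j k, A i j k = - A j i k := h1
  have p132 : ∀ i j k, A i j k = - A i k j := h2
  have p312 : ∀ i j k, A i j k = A j k i := fun i j k => by rw [h1 i j k, h2 j i k, neg_neg]
  have p231 : ∀ i j k, A i j k = A k i j := fun i j k => by rw [h2 i j k, h1 i k j, neg_neg]
  have p321 : ∀ i j k, A i j k = - A k j i := fun i j k => by rw [p312 i j k, h1 j k i]
  rw [h2 j x2 x1,
    h2 j x3 x1,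
    h2 j x3 x2,
    h2 j x4 x1,
    h2 j x4 x2,
    h2 j x4 x3,
    h2 j x5 x1,
    h2 j x5 x2,
    h2 j x5 x3,
    h2 j x5 x4,
    p132 x1 x4 x2,
    p213 x2 x1 x5,
    p231 x2 x4 x1,
    p312 x3 x1 x2,
    p213 x3 x1 x5,
    p321 x3 x2 x1,
    p213 x3 x2 x5,
    p231 x3 x4 x1,
    p231 x3 x4 x2]
  ring


lemma fin6_cases (i : Fin 6) : i = 0 ∨ i = 1 ∨ i = 2 ∨ i = 3 ∨ i = 4 ∨ i = 5 := by
  revert i; decide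

set_option maxRecDepth 10000 in
set_option maxHeartbeats 4000000 in
lemma sq_entry (A : Fin 6 → Fin 6 → Fin 6 → ℝ) (h1 : ∀ i j k, A i j k = - A j i k)
    (h2 : ∀ i j k, A i j k = - A i k j) (i j : Fin 6) :
    ∑ l, entryT A i l * entryT A l j = if i = j then ∑ l, entryT A 0 l * entryT A l 0 else 0 := by
  have z1 : ∀ i k, A i i k = 0 := fun i k => by linarith [h1 i i k]
  have z2 : ∀ i k, A i k k = 0 := fun i k => by linarith [h2 i k k]
  have s1 : ∀ i j k, j < i → A i j k = - A j i k := fun i j k _ => h1 i j k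
  have s2 : ∀ i j k, k < j → A i j k = - A i k j := fun i j k _ => h2 i j k
  have T0 : ∀ j, entryT A 0 j = 2 * (1 * tenP A j 1 2 3 4 5) := fun j => entryT_eq A h1 h2 0 j
  have T1 : ∀ j, entryT A 1 j = 2 * (-1 * tenP A j 0 2 3 4 5) := fun j => entryT_eq A h1 h2 1 j
  have T2 : ∀ j, entryT A 2 j = 2 * (-1 * tenP A j 1 0 3 4 5) := fun j => entryT_eq A h1 h2 2 j
  have T3 : ∀ j, entryT A 3 j = 2 * (-1 * tenP A j 1 2 0 4 5) := fun j => entryT_eq A h1 h2 3 j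
  have T4 : ∀ j, entryT A 4 j = 2 * (-1 * tenP A j 1 2 3 0 5) := fun j => entryT_eq A h1 h2 4 j
  have T5 : ∀ j, entryT A 5 j = 2 * (-1 * tenP A j 1 2 3 4 0) := fun j => entryT_eq A h1 h2 5 j
  rw [Fin.sum_univ_six, Fin.sum_univ_six]
  rcases fin6_cases i with rfl | rfl | rfl | rfl | rfl | rfl <;>
  rcases fin6_cases j with rfl | rfl | rfl | rfl | rfl | rfl <;>
  (simp only [Fin.reduceEq, if_true, if_false] <;>
  simp only [T0, T1, T2, T3, T4, T5] <;>
  simp only [tenP] <;>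
  simp only [z1, z2, s1, s2, Fin.reduceLT, zero_mul, mul_zero, add_zero, zero_add, sub_zero] <;>
  ring)

open Equiv in
lemma entry_formula {W : Type*} [AddCommGroup W] [Module ℝ W]
    (b : Module.Basis (Fin 6) ℝ W) (Ω : AlternatingMap ℝ W ℝ (Fin 3)) (i j : Fin 6) :
    2 * wedge (oneForm (b.coord i)) (wedge (Ω.curryLeft (b j)) Ω) b =
      entryT (fun i j k => Ω ![b i, b j, b k]) i j := by
  rw [wedge_one_five (b.coord i) (wedge (Ω.curryLeft (b j)) Ω) b, Finset.sum_eq_single i]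
  · have h := wedge_two_three (Ω.curryLeft (b j)) Ω (fun t => b (swap 0 i t.succ))
    rw [Module.Basis.coord_apply, Module.Basis.repr_self, Finsupp.single_eq_same, one_mul,
      mul_left_comm]
    refine (congrArg _ h).trans ?_
    unfold entryT
    refine congrArg _ (Finset.sum_congr rfl fun p _ => Finset.sum_congr rfl fun q _ => ?_)
    refine congrArg _ (congrArg₂ _ rfl (congrArg _ ?_))
    funext t
    fin_cases t <;> rfl
  · intro p _ hp
    simp [Module.Basis.coord_apply, Module.Basis.repr_self, Finsupp.single_apply, hp]
  · simp

/-- If `λ(Ω) < 0` then `I_Ω = (−λ(Ω))^{−1/2}·K_Ω` satisfies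
`I_Ω ∘ I_Ω = −id`, i.e. `I_Ω` is a complex structure on `W`. -/
theorem stmt7 (W : Type*) [AddCommGroup W] [Module ℝ W] [FiniteDimensional ℝ W]
    (hdim : Module.finrank ℝ W = 6)
    (ε : AlternatingMap ℝ W ℝ (Fin 6)) (hε : ε ≠ 0)
    (K : AlternatingMap ℝ W ℝ (Fin 3) → W →ₗ[ℝ] W)
    (hK : ∀ (Ω : AlternatingMap ℝ W ℝ (Fin 3)) (θ : W →ₗ[ℝ] ℝ) (v : W),
      wedge (oneForm θ) (wedge (Ω.curryLeft v) Ω) = θ (K Ω v) • ε)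
    (lam : AlternatingMap ℝ W ℝ (Fin 3) → ℝ)
    (hlam : ∀ Ω, lam Ω = (6 : ℝ)⁻¹ * LinearMap.trace ℝ W (K Ω ∘ₗ K Ω))
    (Ω : AlternatingMap ℝ W ℝ (Fin 3)) (hΩ : lam Ω < 0) :
    ((Real.sqrt (-lam Ω))⁻¹ • K Ω) ∘ₗ ((Real.sqrt (-lam Ω))⁻¹ • K Ω) =
      -(LinearMap.id : W →ₗ[ℝ] W) := by
  set b : Module.Basis (Fin 6) ℝ W := Module.finBasisOfFinrankEq ℝ W hdim with hb
  have hc : ε b ≠ 0 := (ε.map_basis_ne_zero_iff b).mpr hε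
  set A : Fin 6 → Fin 6 → Fin 6 → ℝ := fun i j k => Ω ![b i, b j, b k] with hA
  have h1 : ∀ i j k, A i j k = - A j i k := by
    intro i j k
    have h := Ω.map_swap ![b j, b i, b k] (i := 0) (j := 1) (by decide)
    rw [hA]
    change Ω _ = - Ω _
    rw [← h]
    congr 1
    funext t
    fin_cases t <;> rfl
  have h2 : ∀ i j k, A i j k = - A i k j := by
    intro i j k
    have h := Ω.map_swap ![b i, b k, b j] (i := 1) (j := 2) (by decide)
    rw [hA]
    change Ω _ = - Ω _
    rw [← h]
    congr 1
    funext t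
    fin_cases t <;> rfl
  set k := LinearMap.toMatrix b b (K Ω) with hk
  have hent : ∀ i j, 2 * (k i j * ε b) = entryT A i j := by
    intro i j
    rw [← entry_formula b Ω i j, hK Ω (b.coord i) (b j)]
    simp [hk, LinearMap.toMatrix_apply]
  have hsq := sq_entry A h1 h2
  simp only [← hent] at hsq
  have hkk : k * k = (∑ l, k 0 l * k l 0) • (1 : Matrix (Fin 6) (Fin 6) ℝ) := by
    ext i j
    have h := hsq i j
    have hf : ∀ i j, ∑ l, 2 * (k i l * ε b) * (2 * (k l j * ε b)) =
        (4 * ε b ^ 2) * ∑ l, k i l * k l j := by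
      intro i j
      rw [Finset.mul_sum]
      exact Finset.sum_congr rfl fun l _ => by ring
    rw [hf, hf] at h
    rw [Matrix.mul_apply, Matrix.smul_apply, Matrix.one_apply, smul_eq_mul]
    have h4 : (4 * ε b ^ 2) ≠ 0 := by positivity
    apply mul_left_cancel₀ h4
    rw [h]
    split_ifs <;> simp
  set s := ∑ l, k 0 l * k l 0 with hs
  have hKK : K Ω ∘ₗ K Ω = s • (LinearMap.id : W →ₗ[ℝ] W) := by
    apply (LinearMap.toMatrix b b).injective
    rw [LinearMap.toMatrix_comp b b b, ← hk, hkk, map_smul, LinearMap.toMatrix_id]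
  have hl : lam Ω = s := by
    rw [hlam, hKK, map_smul, LinearMap.trace_id, hdim]
    simp
    ring
  rw [LinearMap.smul_comp, LinearMap.comp_smul, hKK, hl, smul_smul, smul_smul]
  rw [hl] at hΩ
  have hp : 0 < -s := by linarith
  have h5 : (√(-s))⁻¹ * (√(-s))⁻¹ * s = -1 := by
    rw [← mul_inv, Real.mul_self_sqrt hp.le]
    have hs0 : s ≠ 0 := hΩ.ne
    rw [inv_neg, neg_mul, inv_mul_cancel₀ hs0]
  rw [h5, neg_one_smul]
end
end

section
/- Suppose Ω ∈ Λ³W* satisfies λ(Ω) < 0 and Ω = α + ᾱ with α a decomposable complex 3-form on W ⊗ ℂ. Let Ĩ denote the ℂ-linear extension of I_Ω to W ⊗ ℂ. Then exactly one of the two summands α, ᾱ satisfies η(Ĩv₁, v₂, v₃) = i·η(v₁, v₂, v₃) for all v₁, v₂, v₃ ∈ W ⊗ ℂ, and the other satisfies the same identity with i replaced by −i. In particular, Ω is the real part of a 3-form of type (3,0) with respect to the complex structure I_Ω. -/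
open scoped TensorProduct

noncomputable section

section helpers
open Equiv Equiv.Perm

theorem wedge_perm_sum {R A M : Type*} [CommRing R] [CommRing A] [Algebra R A]
    [AddCommGroup M] [Module R M] {m n : ℕ}
    (a : AlternatingMap R M A (Fin m)) (b : AlternatingMap R M A (Fin n))
    (x : Fin (m + n) → M) :
    ((m.factorial * n.factorial : ℕ) : A) * wedge a b x =
      ∑ σ : Perm (Fin (m + n)), ((sign σ : ℤ) : A) *
        (a (fun i => x (σ (Fin.castAdd n i))) * b (fun i => x (σ (Fin.natAdd m i)))) := by
  have h := MultilinearMap.domCoprod_alternization_eq a b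
  have h2 := congrArg (fun f => LinearMap.mul' R A (f (fun i => x (finSumFinEquiv i)))) h
  simp only [Fintype.card_fin, MultilinearMap.alternatization_apply, map_sum] at h2
  have h3 : LinearMap.mul' R A (((m.factorial * n.factorial) • a.domCoprod b)
      (fun i => x (finSumFinEquiv i))) = ((m.factorial * n.factorial : ℕ) : A) * wedge a b x := by
    rw [← nsmul_eq_mul, AlternatingMap.smul_apply, map_nsmul]
    rfl
  rw [h3] at h2
  rw [← h2]
  refine Fintype.sum_equiv finSumFinEquiv.permCongr _ _ (fun σ => ?_)
  rw [Equiv.Perm.sign_permCongr]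
  rw [Units.smul_def, map_zsmul, zsmul_eq_mul]
  congr 1
  simp [MultilinearMap.domCoprod_apply]

theorem wedge3_perm_sum {R A M : Type*} [CommRing R] [CommRing A] [IsDomain A] [CharZero A] [Algebra R A]
    [AddCommGroup M] [Module R M] {m p q : ℕ}
    (a : AlternatingMap R M A (Fin m)) (b : AlternatingMap R M A (Fin p))
    (c : AlternatingMap R M A (Fin q))
    (x : Fin (m + (p + q)) → M) :
    ((m.factorial * (p.factorial * q.factorial) : ℕ) : A) * wedge a (wedge b c) x =
      ∑ σ : Perm (Fin (m + (p + q))), ((sign σ : ℤ) : A) *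
        (a (fun i => x (σ (Fin.castAdd _ i))) *
          (b (fun i => x (σ (Fin.natAdd m (Fin.castAdd _ i)))) *
           c (fun i => x (σ (Fin.natAdd m (Fin.natAdd _ i)))))) := by
  have h1 := wedge_perm_sum a (wedge b c) x
  have h2 := fun σ : Perm (Fin (m + (p + q))) =>
    wedge_perm_sum b c (fun i => x (σ (Fin.natAdd m i)))
  have hne : (((p + q).factorial : ℕ) : A) ≠ 0 := by
    exact_mod_cast Nat.factorial_ne_zero _
  apply mul_left_cancel₀ hne
  have h3 : ∀ τ : Perm (Fin (p + q)),
      ∑ σ : Perm (Fin (m + (p + q))), ((sign σ : ℤ) : A) *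
        (a (fun i => x (σ (Fin.castAdd _ i))) * (((sign τ : ℤ) : A) *
          (b (fun i => x (σ (Fin.natAdd m (τ (Fin.castAdd _ i))))) *
           c (fun i => x (σ (Fin.natAdd m (τ (Fin.natAdd _ i)))))))) =
      ∑ σ : Perm (Fin (m + (p + q))), ((sign σ : ℤ) : A) *
        (a (fun i => x (σ (Fin.castAdd _ i))) *
          (b (fun i => x (σ (Fin.natAdd m (Fin.castAdd _ i)))) *
           c (fun i => x (σ (Fin.natAdd m (Fin.natAdd _ i)))))) := by
    intro τ
    refine Fintype.sum_equiv
      (Equiv.mulRight (finSumFinEquiv.permCongr (Equiv.Perm.sumCongr 1 τ))) _ _ (fun σ => ?_)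
    simp only [Equiv.coe_mulRight, Equiv.Perm.sign_mul, Equiv.Perm.sign_permCongr,
      Equiv.Perm.sign_sumCongr, Equiv.Perm.mul_apply, Equiv.permCongr_apply,
      finSumFinEquiv_symm_apply_castAdd, finSumFinEquiv_symm_apply_natAdd,
      Equiv.Perm.sumCongr_apply, Sum.map_inl, Sum.map_inr, finSumFinEquiv_apply_left,
      finSumFinEquiv_apply_right, Equiv.Perm.one_apply, Equiv.Perm.sign_one]
    push_cast
    ring
  have h4 := Finset.sum_congr (rfl : (Finset.univ : Finset (Perm (Fin (p + q)))) = Finset.univ)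
    (fun τ _ => h3 τ)
  rw [Finset.sum_const, Finset.card_univ, Fintype.card_perm, Fintype.card_fin, nsmul_eq_mul,
    Finset.sum_comm] at h4
  rw [← h4]
  have h5 : ∀ σ : Perm (Fin (m + (p + q))),
      ∑ τ : Perm (Fin (p + q)), ((sign σ : ℤ) : A) *
        (a (fun i => x (σ (Fin.castAdd _ i))) * (((sign τ : ℤ) : A) *
          (b (fun i => x (σ (Fin.natAdd m (τ (Fin.castAdd _ i))))) *
           c (fun i => x (σ (Fin.natAdd m (τ (Fin.natAdd _ i)))))))) =
      ((p.factorial * q.factorial : ℕ) : A) * (((sign σ : ℤ) : A) *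
        (a (fun i => x (σ (Fin.castAdd _ i))) *
          wedge b c (fun i => x (σ (Fin.natAdd m i))))) := by
    intro σ
    rw [← Finset.mul_sum, ← Finset.mul_sum, ← h2 σ]
    ring
  rw [Finset.sum_congr rfl (fun σ _ => h5 σ), ← Finset.mul_sum, ← h1]
  push_cast
  ring

/-- explicit determinant of three covectors on three vectors -/
def det3 {W : Type*} [AddCommGroup W] [Module ℝ W] (ξ₁ ξ₂ ξ₃ : W →ₗ[ℝ] ℂ) (u v w : W) : ℂ :=
  ξ₁ u * (ξ₂ v * ξ₃ w - ξ₂ w * ξ₃ v) - ξ₁ v * (ξ₂ u * ξ₃ w - ξ₂ w * ξ₃ u)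
    + ξ₁ w * (ξ₂ u * ξ₃ v - ξ₂ v * ξ₃ u)

theorem decomp_apply {W : Type*} [AddCommGroup W] [Module ℝ W] (ξ₁ ξ₂ ξ₃ : W →ₗ[ℝ] ℂ)
    (u v w : W) :
    wedge (oneForm ξ₁) (wedge (oneForm ξ₂) (oneForm ξ₃)) ![u, v, w] = det3 ξ₁ ξ₂ ξ₃ u v w := by
  have h := wedge3_perm_sum (oneForm ξ₁) (oneForm ξ₂) (oneForm ξ₃) ![u, v, w]
  have h1 : (((Nat.factorial 1) * (Nat.factorial 1 * Nat.factorial 1) : ℕ) : ℂ) = 1 := by simp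
  rw [h1, one_mul] at h
  refine h.trans ?_
  have h2 := Matrix.det_apply' (Matrix.of fun i j : Fin 3 => ![ξ₁, ξ₂, ξ₃] j (![u, v, w] i))
  rw [Matrix.det_fin_three] at h2
  simp only [Fin.prod_univ_three] at h2
  refine Eq.trans ?_ (h2.symm.trans ?_)
  · refine Finset.sum_congr rfl (fun σ _ => ?_)
    rw [mul_assoc]
    rfl
  · simp [det3]
    ring

theorem K_apply {W : Type*} [AddCommGroup W] [Module ℝ W]
    (Ω : AlternatingMap ℝ W ℝ (Fin 3)) (θ : W →ₗ[ℝ] ℝ) (v : W) (x : Fin 6 → W) :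
    12 * wedge (oneForm θ) (wedge (Ω.curryLeft v) Ω) x =
      ∑ σ : Perm (Fin 6), ((sign σ : ℤ) : ℝ) * (θ (x (σ 0)) * (Ω ![v, x (σ 1), x (σ 2)] *
        Ω ![x (σ 3), x (σ 4), x (σ 5)])) := by
  have h := wedge3_perm_sum (oneForm θ) (Ω.curryLeft v) Ω x
  have h1 : (((Nat.factorial 1) * (Nat.factorial 2 * Nat.factorial 3) : ℕ) : ℝ) = 12 := by
    norm_num [Nat.factorial]
  rw [h1] at h
  refine Eq.trans h ?_
  refine Fintype.sum_equiv (Equiv.refl (Perm (Fin 6))) _ _ (fun σ => ?_)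
  have e1 : Ω.curryLeft v (fun i => x (σ (Fin.natAdd 1 (Fin.castAdd 3 i)))) =
      Ω ![v, x (σ 1), x (σ 2)] := by
    rw [AlternatingMap.curryLeft_apply_apply]
    congr 1
    ext i
    fin_cases i <;> rfl
  have e2 : Ω (fun i => x (σ (Fin.natAdd 1 (Fin.natAdd 2 i)))) =
      Ω ![x (σ 3), x (σ 4), x (σ 5)] := by
    congr 1
    ext i
    fin_cases i <;> rfl
  rw [e1, e2]
  rfl

theorem sum_swap (F : Perm (Fin 6) → ℂ) {i j : Fin 6} (hij : i ≠ j) :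
    ∑ σ : Perm (Fin 6), ((sign σ : ℤ) : ℂ) * F σ =
      ∑ σ : Perm (Fin 6), ((sign σ : ℤ) : ℂ) * (- F (σ * swap i j)) := by
  refine Fintype.sum_equiv (Equiv.mulRight (swap i j)) _ _ (fun σ => ?_)
  simp [Equiv.Perm.sign_mul, Equiv.Perm.sign_swap hij, mul_assoc]

variable {W : Type*}

/-- the alternating sum of a function of six vectors -/
def alt6 (F : W → W → W → W → W → W → ℂ) (x : Fin 6 → W) : ℂ :=
  ∑ σ : Perm (Fin 6), ((sign σ : ℤ) : ℂ) *
    F (x (σ 0)) (x (σ 1)) (x (σ 2)) (x (σ 3)) (x (σ 4)) (x (σ 5))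

theorem alt6_add (F G : W → W → W → W → W → W → ℂ) (x : Fin 6 → W) :
    alt6 (fun a b c d e f => F a b c d e f + G a b c d e f) x = alt6 F x + alt6 G x := by
  simp [alt6, mul_add, Finset.sum_add_distrib]

theorem alt6_smul (k : ℂ) (F : W → W → W → W → W → W → ℂ) (x : Fin 6 → W) :
    alt6 (fun a b c d e f => k * F a b c d e f) x = k * alt6 F x := by
  simp only [alt6, Finset.mul_sum]
  exact Finset.sum_congr rfl (fun σ _ => by ring)

theorem alt6_s01 (F : W → W → W → W → W → W → ℂ) (x : Fin 6 → W) :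
    alt6 F x = alt6 (fun a b c d e f => - F b a c d e f) x :=
  sum_swap (fun σ => F (x (σ 0)) (x (σ 1)) (x (σ 2)) (x (σ 3)) (x (σ 4)) (x (σ 5)))
    (i := 0) (j := 1) (by decide)
theorem alt6_s02 (F : W → W → W → W → W → W → ℂ) (x : Fin 6 → W) :
    alt6 F x = alt6 (fun a b c d e f => - F c b a d e f) x :=
  sum_swap (fun σ => F (x (σ 0)) (x (σ 1)) (x (σ 2)) (x (σ 3)) (x (σ 4)) (x (σ 5)))
    (i := 0) (j := 2) (by decide)
theorem alt6_s03 (F : W → W → W → W → W → W → ℂ) (x : Fin 6 → W) :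
    alt6 F x = alt6 (fun a b c d e f => - F d b c a e f) x :=
  sum_swap (fun σ => F (x (σ 0)) (x (σ 1)) (x (σ 2)) (x (σ 3)) (x (σ 4)) (x (σ 5)))
    (i := 0) (j := 3) (by decide)
theorem alt6_s04 (F : W → W → W → W → W → W → ℂ) (x : Fin 6 → W) :
    alt6 F x = alt6 (fun a b c d e f => - F e b c d a f) x :=
  sum_swap (fun σ => F (x (σ 0)) (x (σ 1)) (x (σ 2)) (x (σ 3)) (x (σ 4)) (x (σ 5)))
    (i := 0) (j := 4) (by decide)
theorem alt6_s05 (F : W → W → W → W → W → W → ℂ) (x : Fin 6 → W) :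
    alt6 F x = alt6 (fun a b c d e f => - F f b c d e a) x :=
  sum_swap (fun σ => F (x (σ 0)) (x (σ 1)) (x (σ 2)) (x (σ 3)) (x (σ 4)) (x (σ 5)))
    (i := 0) (j := 5) (by decide)
theorem alt6_s23 (F : W → W → W → W → W → W → ℂ) (x : Fin 6 → W) :
    alt6 F x = alt6 (fun a b c d e f => - F a b d c e f) x :=
  sum_swap (fun σ => F (x (σ 0)) (x (σ 1)) (x (σ 2)) (x (σ 3)) (x (σ 4)) (x (σ 5)))
    (i := 2) (j := 3) (by decide)
theorem alt6_s24 (F : W → W → W → W → W → W → ℂ) (x : Fin 6 → W) :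
    alt6 F x = alt6 (fun a b c d e f => - F a b e d c f) x :=
  sum_swap (fun σ => F (x (σ 0)) (x (σ 1)) (x (σ 2)) (x (σ 3)) (x (σ 4)) (x (σ 5)))
    (i := 2) (j := 4) (by decide)
theorem alt6_s25 (F : W → W → W → W → W → W → ℂ) (x : Fin 6 → W) :
    alt6 F x = alt6 (fun a b c d e f => - F a b f d e c) x :=
  sum_swap (fun σ => F (x (σ 0)) (x (σ 1)) (x (σ 2)) (x (σ 3)) (x (σ 4)) (x (σ 5)))
    (i := 2) (j := 5) (by decide)
theorem alt6_s14 (F : W → W → W → W → W → W → ℂ) (x : Fin 6 → W) :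
    alt6 F x = alt6 (fun a b c d e f => - F a e c d b f) x :=
  sum_swap (fun σ => F (x (σ 0)) (x (σ 1)) (x (σ 2)) (x (σ 3)) (x (σ 4)) (x (σ 5)))
    (i := 1) (j := 4) (by decide)

/-- if `g` wedges to zero against the 3-form `P` (as a four-term identity), the sum vanishes -/
theorem alt6_cross (g : W → ℂ) (B : W → W → ℂ) (P : W → W → W → ℂ)
    (hP : ∀ a d e f, g a * P d e f - g d * P a e f - g e * P d a f - g f * P d e a = 0)
    (x : Fin 6 → W) :
    alt6 (fun a b c d e f => g a * (B b c * P d e f)) x = 0 := by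
  have h3 := alt6_s03 (fun a b c d e f => g a * (B b c * P d e f)) x
  have h4 := alt6_s04 (fun a b c d e f => g a * (B b c * P d e f)) x
  have h5 := alt6_s05 (fun a b c d e f => g a * (B b c * P d e f)) x
  have h : 4 * alt6 (fun a b c d e f => g a * (B b c * P d e f)) x = 0 := by
    have e1 : 4 * alt6 (fun a b c d e f => g a * (B b c * P d e f)) x =
      alt6 (fun a b c d e f => g a * (B b c * P d e f)) x +
      alt6 (fun a b c d e f => g a * (B b c * P d e f)) x +
      alt6 (fun a b c d e f => g a * (B b c * P d e f)) x +
      alt6 (fun a b c d e f => g a * (B b c * P d e f)) x := by ring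
    rw [e1]
    nth_rewrite 2 [h3]
    nth_rewrite 2 [h4]
    nth_rewrite 2 [h5]
    rw [← alt6_add, ← alt6_add, ← alt6_add]
    refine Finset.sum_eq_zero (fun σ _ => ?_)
    simp only []
    have := hP (x (σ 0)) (x (σ 3)) (x (σ 4)) (x (σ 5))
    linear_combination (((sign σ : ℤ) : ℂ) * B (x (σ 1)) (x (σ 2))) * this
  simpa using h

theorem alt6_same (g : W → ℂ) (P : W → W → W → ℂ) (v : W)
    (hP : ∀ b c d e f, P v b c * P d e f - P v b d * P c e f - P v b e * P d c f
      - P v b f * P d e c = 0)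
    (x : Fin 6 → W) :
    alt6 (fun a b c d e f => g a * (P v b c * P d e f)) x = 0 := by
  have h3 := alt6_s23 (fun a b c d e f => g a * (P v b c * P d e f)) x
  have h4 := alt6_s24 (fun a b c d e f => g a * (P v b c * P d e f)) x
  have h5 := alt6_s25 (fun a b c d e f => g a * (P v b c * P d e f)) x
  have h : 4 * alt6 (fun a b c d e f => g a * (P v b c * P d e f)) x = 0 := by
    have e1 : 4 * alt6 (fun a b c d e f => g a * (P v b c * P d e f)) x =
      alt6 (fun a b c d e f => g a * (P v b c * P d e f)) x +
      alt6 (fun a b c d e f => g a * (P v b c * P d e f)) x +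
      alt6 (fun a b c d e f => g a * (P v b c * P d e f)) x +
      alt6 (fun a b c d e f => g a * (P v b c * P d e f)) x := by ring
    rw [e1]
    nth_rewrite 2 [h3]
    nth_rewrite 2 [h4]
    nth_rewrite 2 [h5]
    rw [← alt6_add, ← alt6_add, ← alt6_add]
    refine Finset.sum_eq_zero (fun σ _ => ?_)
    simp only []
    have := hP (x (σ 1)) (x (σ 2)) (x (σ 3)) (x (σ 4)) (x (σ 5))
    linear_combination (((sign σ : ℤ) : ℂ) * g (x (σ 0))) * this
  simpa using h

theorem alt6_main (g : W → ℂ) (P Q : W → W → W → ℂ) (v : W)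
    (hP : ∀ a b c, g a * P v b c - g b * P v a c - g c * P v b a = g v * P a b c)
    (x : Fin 6 → W) :
    3 * alt6 (fun a b c d e f => g a * (P v b c * Q d e f)) x =
      g v * alt6 (fun a b c d e f => P a b c * Q d e f) x := by
  have h3 := alt6_s01 (fun a b c d e f => g a * (P v b c * Q d e f)) x
  have h4 := alt6_s02 (fun a b c d e f => g a * (P v b c * Q d e f)) x
  have e1 : 3 * alt6 (fun a b c d e f => g a * (P v b c * Q d e f)) x =
    alt6 (fun a b c d e f => g a * (P v b c * Q d e f)) x +
    alt6 (fun a b c d e f => g a * (P v b c * Q d e f)) x +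
    alt6 (fun a b c d e f => g a * (P v b c * Q d e f)) x := by ring
  rw [e1]
  nth_rewrite 2 [h3]
  nth_rewrite 2 [h4]
  rw [← alt6_add, ← alt6_add, ← alt6_smul]
  refine Finset.sum_congr rfl (fun σ _ => ?_)
  simp only []
  have := hP (x (σ 0)) (x (σ 1)) (x (σ 2))
  linear_combination (((sign σ : ℤ) : ℂ) * Q (x (σ 3)) (x (σ 4)) (x (σ 5))) * this

theorem alt6_flip (P Q : W → W → W → ℂ) (x : Fin 6 → W) :
    alt6 (fun a b c d e f => P a b c * Q d e f) x =
      - alt6 (fun a b c d e f => Q a b c * P d e f) x := by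
  rw [alt6_s03, alt6_s14, alt6_s25]
  rw [neg_eq_neg_one_mul (alt6 _ _), ← alt6_smul]
  congr 1
  funext a b c d e f
  ring

theorem alt6_conj (F : W → W → W → W → W → W → ℂ) (x : Fin 6 → W) :
    (starRingEnd ℂ) (alt6 F x) = alt6 (fun a b c d e f => (starRingEnd ℂ) (F a b c d e f)) x := by
  simp [alt6]


variable [AddCommGroup W] [Module ℝ W]

/-- the scalar-valued version of `α ∧ ᾱ` -/
def cc (ξ₁ ξ₂ ξ₃ : W →ₗ[ℝ] ℂ) (y : Fin 6 → W) : ℂ :=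
  alt6 (fun a b c d e f => det3 ξ₁ ξ₂ ξ₃ a b c * (starRingEnd ℂ) (det3 ξ₁ ξ₂ ξ₃ d e f)) y

theorem cc_conj (ξ₁ ξ₂ ξ₃ : W →ₗ[ℝ] ℂ) (y : Fin 6 → W) :
    (starRingEnd ℂ) (cc ξ₁ ξ₂ ξ₃ y) = - cc ξ₁ ξ₂ ξ₃ y := by
  unfold cc
  rw [alt6_conj]
  simp only [map_mul, Complex.conj_conj]
  exact alt6_flip (fun a b c => (starRingEnd ℂ) (det3 ξ₁ ξ₂ ξ₃ a b c)) (det3 ξ₁ ξ₂ ξ₃) y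

theorem det3_plucker (ξ₁ ξ₂ ξ₃ : W →ₗ[ℝ] ℂ) (v b c d e f : W) :
    det3 ξ₁ ξ₂ ξ₃ v b c * det3 ξ₁ ξ₂ ξ₃ d e f - det3 ξ₁ ξ₂ ξ₃ v b d * det3 ξ₁ ξ₂ ξ₃ c e f
      - det3 ξ₁ ξ₂ ξ₃ v b e * det3 ξ₁ ξ₂ ξ₃ d c f
      - det3 ξ₁ ξ₂ ξ₃ v b f * det3 ξ₁ ξ₂ ξ₃ d e c = 0 := by
  unfold det3
  ring

theorem key_relation (Ω : AlternatingMap ℝ W ℝ (Fin 3)) (ξ₁ ξ₂ ξ₃ : W →ₗ[ℝ] ℂ)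
    (hΩ : ∀ u v w, (Ω ![u, v, w] : ℂ) =
      det3 ξ₁ ξ₂ ξ₃ u v w + (starRingEnd ℂ) (det3 ξ₁ ξ₂ ξ₃ u v w))
    (ε : AlternatingMap ℝ W ℝ (Fin 6)) (K : W →ₗ[ℝ] W)
    (hK : ∀ (θ : W →ₗ[ℝ] ℝ) (v : W),
      wedge (oneForm θ) (wedge (Ω.curryLeft v) Ω) = θ (K v) • ε)
    (g : W →ₗ[ℝ] ℂ)
    (hg : ∀ a d e f, g a * det3 ξ₁ ξ₂ ξ₃ d e f - g d * det3 ξ₁ ξ₂ ξ₃ a e f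
      - g e * det3 ξ₁ ξ₂ ξ₃ d a f - g f * det3 ξ₁ ξ₂ ξ₃ d e a = 0)
    (hg' : ∀ v a b c, g a * det3 ξ₁ ξ₂ ξ₃ v b c - g b * det3 ξ₁ ξ₂ ξ₃ v a c
      - g c * det3 ξ₁ ξ₂ ξ₃ v b a = g v * det3 ξ₁ ξ₂ ξ₃ a b c)
    (v : W) (y : Fin 6 → W) :
    36 * g (K v) * (ε y : ℂ) = g v * cc ξ₁ ξ₂ ξ₃ y := by
  have hreal : ∀ θ : W →ₗ[ℝ] ℝ, 12 * ((θ (K v) : ℝ) : ℂ) * (ε y : ℂ) =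
      alt6 (fun a b c d e f => ((θ a : ℝ) : ℂ) * ((Ω ![v, b, c] : ℂ) * (Ω ![d, e, f] : ℂ))) y := by
    intro θ
    have h := K_apply Ω θ v y
    rw [hK θ v] at h
    have h2 := congrArg (fun r : ℝ => (r : ℂ)) h
    simp only [AlternatingMap.smul_apply, smul_eq_mul] at h2
    push_cast at h2
    rw [mul_assoc]
    exact h2
  have h1 := hreal (Complex.reLm ∘ₗ g)
  have h2 := hreal (Complex.imLm ∘ₗ g)
  have h12 : 12 * g (K v) * (ε y : ℂ) =
      alt6 (fun a b c d e f => g a * ((Ω ![v, b, c] : ℂ) * (Ω ![d, e, f] : ℂ))) y := by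
    have e1 : (fun a b c d e f => g a * ((Ω ![v, b, c] : ℂ) * (Ω ![d, e, f] : ℂ))) =
      (fun a b c d e f =>
        (((Complex.reLm ∘ₗ g) a : ℝ) : ℂ) * ((Ω ![v, b, c] : ℂ) * (Ω ![d, e, f] : ℂ)) +
        Complex.I * ((((Complex.imLm ∘ₗ g) a : ℝ) : ℂ) *
          ((Ω ![v, b, c] : ℂ) * (Ω ![d, e, f] : ℂ)))) := by
      funext a b c d e f
      have := Complex.re_add_im (g a)
      simp only [LinearMap.comp_apply, Complex.reLm_coe, Complex.imLm_coe]
      linear_combination (-((Ω ![v, b, c] : ℂ) * (Ω ![d, e, f] : ℂ))) * this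
    rw [e1, alt6_add, alt6_smul, ← h1, ← h2]
    have := Complex.re_add_im (g (K v))
    simp only [LinearMap.comp_apply, Complex.reLm_coe, Complex.imLm_coe]
    linear_combination (-(12 * (ε y : ℂ))) * this
  set P := det3 ξ₁ ξ₂ ξ₃ with hPdef
  set Q : W → W → W → ℂ := fun a b c => (starRingEnd ℂ) (P a b c) with hQdef
  have e2 : (fun a b c d e f => g a * ((Ω ![v, b, c] : ℂ) * (Ω ![d, e, f] : ℂ))) =
      (fun a b c d e f => g a * (P v b c * P d e f) + g a * (Q v b c * Q d e f)
        + g a * (Q v b c * P d e f) + g a * (P v b c * Q d e f)) := by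
    funext a b c d e f
    rw [hΩ, hΩ]
    ring
  rw [e2, alt6_add, alt6_add, alt6_add] at h12
  rw [alt6_same g P v (fun b c d e f => det3_plucker ξ₁ ξ₂ ξ₃ v b c d e f),
    alt6_same g Q v (fun b c d e f => by
      have := congrArg (starRingEnd ℂ) (det3_plucker ξ₁ ξ₂ ξ₃ v b c d e f)
      simpa using this),
    alt6_cross g (fun b c => Q v b c) P hg] at h12
  have h3 := alt6_main g P Q v (hg' v) y
  have h4 : cc ξ₁ ξ₂ ξ₃ y = alt6 (fun a b c d e f => P a b c * Q d e f) y := rfl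
  rw [h4, ← h3]
  linear_combination 3 * h12

theorem cc_eq_zero (ξ₁ ξ₂ ξ₃ : W →ₗ[ℝ] ℂ) (y : Fin 6 → W) (i : Fin 6)
    (h1 : ξ₁ (y i) = 0) (h2 : ξ₂ (y i) = 0) (h3 : ξ₃ (y i) = 0) : cc ξ₁ ξ₂ ξ₃ y = 0 := by
  unfold cc alt6
  refine Finset.sum_eq_zero (fun σ _ => ?_)
  obtain ⟨j, rfl⟩ := σ.surjective i
  fin_cases j <;> simp at h1 h2 h3 <;> simp [det3, h1, h2, h3]

theorem coord_eq_zero (b : Module.Basis (Fin 6) ℝ W) (ε : AlternatingMap ℝ W ℝ (Fin 6))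
    (hε : ε ≠ 0) (w : W) (h : ∀ i, ε (Function.update b i w) = 0) : w = 0 := by
  have hb : ε b ≠ 0 := (AlternatingMap.map_basis_ne_zero_iff b ε).2 hε
  apply b.ext_elem
  intro i
  have h1 := h i
  rw [ε.eq_smul_basis_det b, AlternatingMap.smul_apply, Module.Basis.det_apply,
    Module.Basis.toMatrix_update, Module.Basis.toMatrix_self, ← Matrix.cramer_apply,
    Matrix.cramer_one] at h1
  simpa [hb] using h1

end helpers

/-- Suppose `λ(Ω) < 0` and `Ω = α + ᾱ` with `α` a decomposable
complex 3-form on `W ⊗ ℂ`.  Then exactly one of `α, ᾱ` satisfies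
`η(Ĩv₁,v₂,v₃) = i·η(v₁,v₂,v₃)` (where `Ĩ` is the `ℂ`-linear extension of
`I_Ω = (−λ(Ω))^{−1/2}K_Ω`), and the other satisfies the identity with `i`
replaced by `−i`.  (Complex forms on `W ⊗ ℂ` are identified with their
restrictions to `W`; by complex multilinearity the eigenform identities need
only be imposed for real vectors.)  In particular `Ω` is the real part of a
`(3,0)`-form for `I_Ω`. -/
theorem stmt8 (W : Type*) [AddCommGroup W] [Module ℝ W] [FiniteDimensional ℝ W]
    (hdim : Module.finrank ℝ W = 6)
    (ε : AlternatingMap ℝ W ℝ (Fin 6)) (hε : ε ≠ 0)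
    (K : AlternatingMap ℝ W ℝ (Fin 3) → W →ₗ[ℝ] W)
    (hK : ∀ (Ω : AlternatingMap ℝ W ℝ (Fin 3)) (θ : W →ₗ[ℝ] ℝ) (v : W),
      wedge (oneForm θ) (wedge (Ω.curryLeft v) Ω) = θ (K Ω v) • ε)
    (lam : AlternatingMap ℝ W ℝ (Fin 3) → ℝ)
    (hlam : ∀ Ω, lam Ω = (6 : ℝ)⁻¹ * LinearMap.trace ℝ W (K Ω ∘ₗ K Ω))
    (Ω : AlternatingMap ℝ W ℝ (Fin 3)) (hΩ : lam Ω < 0)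
    (α : AlternatingMap ℝ W ℂ (Fin 3)) (hα : IsDecomposable α)
    (hsum : cx Ω = α + conjForm α) :
    ∀ I : W →ₗ[ℝ] W, I = (Real.sqrt (-lam Ω))⁻¹ • K Ω →
      ((∀ v₁ v₂ v₃ : W, α ![I v₁, v₂, v₃] = Complex.I * α ![v₁, v₂, v₃]) ∧
          (∀ v₁ v₂ v₃ : W,
            conjForm α ![I v₁, v₂, v₃] = -Complex.I * conjForm α ![v₁, v₂, v₃]) ∧
          ¬(∀ v₁ v₂ v₃ : W,
            conjForm α ![I v₁, v₂, v₃] = Complex.I * conjForm α ![v₁, v₂, v₃])) ∨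
        ((∀ v₁ v₂ v₃ : W,
            conjForm α ![I v₁, v₂, v₃] = Complex.I * conjForm α ![v₁, v₂, v₃]) ∧
          (∀ v₁ v₂ v₃ : W, α ![I v₁, v₂, v₃] = -Complex.I * α ![v₁, v₂, v₃]) ∧
          ¬(∀ v₁ v₂ v₃ : W, α ![I v₁, v₂, v₃] = Complex.I * α ![v₁, v₂, v₃])) := by
  intro I hI
  obtain ⟨ξ₁, ξ₂, ξ₃, hξ⟩ := hα
  have hαP : ∀ u v w, α ![u, v, w] = det3 ξ₁ ξ₂ ξ₃ u v w := by
    intro u v w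
    rw [hξ]
    exact decomp_apply ξ₁ ξ₂ ξ₃ u v w
  have hαQ : ∀ u v w, conjForm α ![u, v, w] = (starRingEnd ℂ) (det3 ξ₁ ξ₂ ξ₃ u v w) := by
    intro u v w
    rw [← hαP]
    rfl
  have hΩP : ∀ u v w, (Ω ![u, v, w] : ℂ) =
      det3 ξ₁ ξ₂ ξ₃ u v w + (starRingEnd ℂ) (det3 ξ₁ ξ₂ ξ₃ u v w) := by
    intro u v w
    have h := congrArg (fun f => f ![u, v, w]) hsum
    simp only [AlternatingMap.add_apply] at h
    rw [hαP, hαQ] at h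
    exact h
  have b : Module.Basis (Fin 6) ℝ W := Module.finBasisOfFinrankEq ℝ W hdim
  have hb : ε b ≠ 0 := (AlternatingMap.map_basis_ne_zero_iff b ε).2 hε
  have hbc : (ε b : ℂ) ≠ 0 := by exact_mod_cast hb
  have k1 := key_relation Ω ξ₁ ξ₂ ξ₃ hΩP ε (K Ω) (hK Ω) ξ₁
    (by intros; unfold det3; ring) (by intros; unfold det3; ring)
  have k2 := key_relation Ω ξ₁ ξ₂ ξ₃ hΩP ε (K Ω) (hK Ω) ξ₂
    (by intros; unfold det3; ring) (by intros; unfold det3; ring)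
  have k3 := key_relation Ω ξ₁ ξ₂ ξ₃ hΩP ε (K Ω) (hK Ω) ξ₃
    (by intros; unfold det3; ring) (by intros; unfold det3; ring)
  -- the eigenvalue is purely imaginary
  obtain ⟨μ, hμ⟩ : ∃ μ : ℝ, cc ξ₁ ξ₂ ξ₃ b = 36 * (ε b : ℂ) * (μ * Complex.I) := by
    have h := cc_conj ξ₁ ξ₂ ξ₃ b
    have hre : (cc ξ₁ ξ₂ ξ₃ b).re = 0 := by
      have := congrArg Complex.re h
      simp at this
      linarith
    refine ⟨(cc ξ₁ ξ₂ ξ₃ b).im / (36 * ε b), ?_⟩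
    have hz := Complex.re_add_im (cc ξ₁ ξ₂ ξ₃ b)
    rw [hre, Complex.ofReal_zero, zero_add] at hz
    push_cast
    field_simp
    exact hz.symm
  have e1 : ∀ v, ξ₁ (K Ω v) = μ * Complex.I * ξ₁ v := by
    intro v
    have h := k1 v b
    rw [hμ] at h
    apply mul_left_cancel₀ hbc
    linear_combination h / 36
  have e2 : ∀ v, ξ₂ (K Ω v) = μ * Complex.I * ξ₂ v := by
    intro v
    have h := k2 v b
    rw [hμ] at h
    apply mul_left_cancel₀ hbc
    linear_combination h / 36
  have e3 : ∀ v, ξ₃ (K Ω v) = μ * Complex.I * ξ₃ v := by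
    intro v
    have h := k3 v b
    rw [hμ] at h
    apply mul_left_cancel₀ hbc
    linear_combination h / 36
  have hμ0 : μ ≠ 0 := by
    intro h0
    subst h0
    have hKK : K Ω ∘ₗ K Ω = 0 := by
      ext v
      have hΩ0 : ∀ p q, Ω ![K Ω v, p, q] = 0 := by
        intro p q
        have h := hΩP (K Ω v) p q
        have hd : det3 ξ₁ ξ₂ ξ₃ (K Ω v) p q = 0 := by
          unfold det3
          rw [e1, e2, e3]
          simp
        rw [hd] at h
        simpa using h
      show K Ω (K Ω v) = 0
      rw [← Module.forall_dual_apply_eq_zero_iff ℝ]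
      intro θ
      have h := K_apply Ω θ (K Ω v) b
      rw [hK Ω θ] at h
      simp only [hΩ0, zero_mul, mul_zero, Finset.sum_const_zero] at h
      simpa [hb] using h
    have h := hlam Ω
    rw [hKK] at h
    simp at h
    linarith
  have hcc : cc ξ₁ ξ₂ ξ₃ b ≠ 0 := by
    rw [hμ]
    simp [hb, hμ0]
  have hinj : ∀ w, ξ₁ w = 0 → ξ₂ w = 0 → ξ₃ w = 0 → w = 0 := by
    intro w h1 h2 h3
    obtain ⟨v, hv⟩ : ∃ v, ξ₁ v ≠ 0 := by
      by_contra! hcon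
      apply hcc
      unfold cc alt6
      refine Finset.sum_eq_zero (fun σ _ => ?_)
      simp [det3, hcon]
    refine coord_eq_zero b ε hε w (fun i => ?_)
    have h := k1 v (Function.update b i w)
    rw [cc_eq_zero ξ₁ ξ₂ ξ₃ (Function.update b i w) i (by simpa using h1) (by simpa using h2)
      (by simpa using h3), e1] at h
    simpa [hv, hμ0] using h
  have hII : (Complex.I) * Complex.I = -1 := Complex.I_mul_I
  have hKK : K Ω ∘ₗ K Ω = (-(μ ^ 2)) • LinearMap.id := by
    ext v
    have h0 : K Ω (K Ω v) + (μ ^ 2) • v = 0 := by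
      apply hinj
      · rw [map_add, map_smul, e1, e1, Complex.real_smul]
        push_cast
        linear_combination (μ ^ 2 * ξ₁ v) * hII
      · rw [map_add, map_smul, e2, e2, Complex.real_smul]
        push_cast
        linear_combination (μ ^ 2 * ξ₂ v) * hII
      · rw [map_add, map_smul, e3, e3, Complex.real_smul]
        push_cast
        linear_combination (μ ^ 2 * ξ₃ v) * hII
    have := eq_neg_of_add_eq_zero_left h0
    simpa using this
  have hl : lam Ω = -(μ ^ 2) := by
    rw [hlam, hKK, map_smul, LinearMap.trace_id, hdim]
    simp
    ring
  have hsq : Real.sqrt (-lam Ω) = |μ| := by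
    rw [hl, neg_neg, Real.sqrt_sq_eq_abs]
  rw [hsq] at hI
  have main : ∀ s : ℝ, |μ|⁻¹ * μ = s → ∀ u v w,
      det3 ξ₁ ξ₂ ξ₃ (I u) v w = s * Complex.I * det3 ξ₁ ξ₂ ξ₃ u v w := by
    intro s hs u v w
    have f : ∀ ξ : W →ₗ[ℝ] ℂ, (∀ v, ξ (K Ω v) = μ * Complex.I * ξ v) →
        ξ (I u) = s * Complex.I * ξ u := by
      intro ξ h
      rw [hI, LinearMap.smul_apply, map_smul, h, Complex.real_smul, ← hs]
      push_cast
      ring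
    unfold det3
    rw [f ξ₁ e1, f ξ₂ e2, f ξ₃ e3]
    ring
  have hne : ¬ ∀ u v w, det3 ξ₁ ξ₂ ξ₃ u v w = 0 := by
    intro hcon
    apply hcc
    unfold cc alt6
    refine Finset.sum_eq_zero (fun σ _ => ?_)
    simp [hcon]
  simp only [hαP, hαQ]
  rcases lt_or_gt_of_ne hμ0 with hneg | hpos
  · right
    have hs := main (-1) (by rw [abs_of_neg hneg]; field_simp)
    refine ⟨fun u v w => ?_, fun u v w => ?_, fun hcon => hne (fun u v w => ?_)⟩
    · rw [hs]
      simp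
    · rw [hs]
      simp
    · have h := hcon u v w
      rw [hs] at h
      have h2 : Complex.I * det3 ξ₁ ξ₂ ξ₃ u v w = 0 := by
        push_cast at h
        linear_combination (-1 / 2) * h
      simpa using h2
  · left
    have hs := main 1 (by rw [abs_of_pos hpos]; field_simp)
    refine ⟨fun u v w => ?_, fun u v w => ?_, fun hcon => hne (fun u v w => ?_)⟩
    · rw [hs]
      simp
    · rw [hs]
      simp
    · have h := hcon u v w
      rw [hs] at h
      have h2 : Complex.I * (starRingEnd ℂ) (det3 ξ₁ ξ₂ ξ₃ u v w) = 0 := by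
        simp only [map_mul, Complex.conj_I, Complex.conj_ofReal] at h
        push_cast at h
        linear_combination (-1 / 2) * h
      simpa using h2
end
end

section
/- Suppose Ω ∈ Λ³W* satisfies λ(Ω) < 0. Then there exists a unique real 3-form Ω̂ ∈ Λ³W* such that Ω + iΩ̂ is a decomposable complex 3-form on W ⊗ ℂ and Ω ∧ Ω̂ is a positive multiple of ε. Moreover Ω ∧ Ω̂ = 2·√(−λ(Ω))·ε, λ(Ω̂) = λ(Ω), and the 3-form associated to Ω̂ by the same construction is −Ω (that is, the hat operation squares to −identity). -/
open scoped TensorProduct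

noncomputable section

open Equiv in
def peel {N : ℕ} (p : Fin (N+1) × Perm (Fin N)) : Perm (Fin (N+1)) :=
  (Fin.cycleRange p.1).symm * Perm.decomposeFin.symm (0, p.2)

lemma peel_zero {N : ℕ} (p : Fin (N+1) × Equiv.Perm (Fin N)) : peel p 0 = p.1 := by
  simp [peel]

lemma peel_succ {N : ℕ} (p : Fin (N+1) × Equiv.Perm (Fin N)) (k : Fin N) :
    peel p k.succ = p.1.succAbove (p.2 k) := by
  simp [peel]

lemma peel_sign {N : ℕ} (p : Fin (N+1) × Equiv.Perm (Fin N)) :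
    Equiv.Perm.sign (peel p) = (-1) ^ (p.1 : ℕ) * Equiv.Perm.sign p.2 := by
  simp [peel, Equiv.Perm.sign_mul]

lemma peel_bij {N : ℕ} : Function.Bijective (peel (N := N)) := by
  rw [Fintype.bijective_iff_injective_and_card]
  refine ⟨?_, by simp [Fintype.card_perm, Nat.factorial_succ]⟩
  rintro ⟨i, s⟩ ⟨j, t⟩ h
  have h0 : i = j := by simpa [peel_zero] using congrArg (fun e => e 0) h
  subst h0
  congr
  ext k
  have := congrArg (fun e => e k.succ) h
  simp only [peel_succ] at this
  exact congrArg _ (Fin.succAbove_right_injective this)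

/-- signed sum over permutations -/
def U {M A : Type*} [CommRing A] (N : ℕ) (F : (Fin N → M) → A) (v : Fin N → M) : A :=
  ∑ σ : Equiv.Perm (Fin N), (((Equiv.Perm.sign σ : ℤˣ) : ℤ) : A) * F (v ∘ σ)

lemma U_zero {M A : Type*} [CommRing A] (F : (Fin 0 → M) → A) (v : Fin 0 → M) :
    U 0 F v = F v := by
  have : v = fun i => v i := rfl
  simp [U, Subsingleton.elim _ v]

lemma U_succ {M A : Type*} [CommRing A] (N : ℕ) (F : (Fin (N+1) → M) → A) (v : Fin (N+1) → M) :
    U (N+1) F v = ∑ i : Fin (N+1), (-1) ^ (i : ℕ) *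
      U N (fun w => F (Fin.cons (v i) w)) (i.removeNth v) := by
  unfold U
  rw [← Function.Bijective.sum_comp peel_bij, Fintype.sum_prod_type]
  refine Finset.sum_congr rfl fun i _ => ?_
  rw [Finset.mul_sum]
  refine Finset.sum_congr rfl fun s _ => ?_
  have : v ∘ (peel (i, s)) = Fin.cons (v i) (i.removeNth v ∘ s) := by
    ext k
    refine Fin.cases ?_ (fun k => ?_) k
    · simp [peel_zero]
    · simp [peel_succ, Fin.removeNth]
  rw [this, peel_sign]
  push_cast
  ring

lemma wedge_U {R A M : Type*} [CommRing R] [CommRing A] [Algebra R A]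
    [AddCommGroup M] [Module R M] {m n : ℕ}
    (α : AlternatingMap R M A (Fin m)) (β : AlternatingMap R M A (Fin n)) (v : Fin (m+n) → M) :
    ((m.factorial * n.factorial : ℕ) : A) * wedge α β v =
      U (m+n) (fun w => α (fun i => w (Fin.castAdd n i)) * β (fun i => w (Fin.natAdd m i))) v := by
  have h := MultilinearMap.domCoprod_alternization_eq α β
  have h2 := congrArg (fun F => LinearMap.mul' R A (F (fun i => v (finSumFinEquiv i)))) h
  simp only [Fintype.card_fin, AlternatingMap.smul_apply, map_nsmul] at h2
  rw [nsmul_eq_mul] at h2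
  have h3 : wedge α β v = LinearMap.mul' R A ((α.domCoprod β) (fun i => v (finSumFinEquiv i))) := rfl
  rw [h3, ← h2, MultilinearMap.alternatization_apply, map_sum, U]
  refine Fintype.sum_equiv finSumFinEquiv.permCongr _ _ fun σ => ?_
  rw [Units.smul_def, map_zsmul, zsmul_eq_mul]
  simp [Function.comp_def]


set_option linter.unusedSectionVars false
set_option linter.unusedSimpArgs false

lemma U_alt {R A M : Type*} [CommRing R] [CommRing A] [Algebra R A]
    [AddCommGroup M] [Module R M] {n : ℕ} (c : A)
    (β : AlternatingMap R M A (Fin n)) (v : Fin n → M) :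
    U n (fun w => c * β w) v = (n.factorial : A) * (c * β v) := by
  unfold U
  have : ∀ σ : Equiv.Perm (Fin n),
      (((Equiv.Perm.sign σ : ℤˣ) : ℤ) : A) * (c * β (v ∘ σ)) = c * β v := by
    intro σ
    rw [AlternatingMap.map_perm, Units.smul_def, zsmul_eq_mul]
    rcases Int.units_eq_one_or (Equiv.Perm.sign σ) with h | h <;> simp [h]
  simp [this, Fintype.card_perm]

lemma U_congr {M A : Type*} [CommRing A] {N : ℕ} {F G : (Fin N → M) → A} {v : Fin N → M}
    (h : ∀ w, F w = G w) : U N F v = U N G v := by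
  rw [funext h]

section wedges
variable {R A M : Type*} [CommRing R] [Field A] [CharZero A] [Algebra R A]
    [AddCommGroup M] [Module R M]

lemma wedge_one_five_s9 (θ : M →ₗ[R] A) (β : AlternatingMap R M A (Fin 5)) (v : Fin 6 → M) :
    wedge (oneForm θ) β v = ∑ i : Fin 6, (-1) ^ (i : ℕ) * (θ (v i) * β (i.removeNth v)) := by
  have h := wedge_U (oneForm θ) β v
  have h2 : U (1+5) (fun w => (oneForm θ) (fun i => w (Fin.castAdd 5 i)) *
      β (fun i => w (Fin.natAdd 1 i))) v =
      ∑ i : Fin 6, (-1) ^ (i : ℕ) * ((5:ℕ).factorial * (θ (v i) * β (i.removeNth v))) := by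
    refine (U_succ 5 _ v).trans ?_
    refine Finset.sum_congr rfl fun i _ => ?_
    rw [← U_alt]
    refine congrArg _ (U_congr fun w => congrArg₂ (· * ·) rfl (congrArg _ ?_))
    ext k; fin_cases k <;> rfl
  rw [h2] at h
  have h5 : ((Nat.factorial 5 : ℕ) : A) ≠ 0 := by exact_mod_cast Nat.factorial_ne_zero 5
  rw [Nat.factorial_one, one_mul] at h
  refine mul_left_cancel₀ h5 (h.trans ?_)
  rw [Finset.mul_sum]
  exact Finset.sum_congr rfl fun i _ => by ring

lemma wedge_one_two (θ : M →ₗ[R] A) (β : AlternatingMap R M A (Fin 2)) (v : Fin 3 → M) :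
    wedge (oneForm θ) β v = ∑ i : Fin 3, (-1) ^ (i : ℕ) * (θ (v i) * β (i.removeNth v)) := by
  have h := wedge_U (oneForm θ) β v
  have h2 : U (1+2) (fun w => (oneForm θ) (fun i => w (Fin.castAdd 2 i)) *
      β (fun i => w (Fin.natAdd 1 i))) v =
      ∑ i : Fin 3, (-1) ^ (i : ℕ) * ((2:ℕ).factorial * (θ (v i) * β (i.removeNth v))) := by
    refine (U_succ 2 _ v).trans ?_
    refine Finset.sum_congr rfl fun i _ => ?_
    rw [← U_alt]
    refine congrArg _ (U_congr fun w => congrArg₂ (· * ·) rfl (congrArg _ ?_))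
    ext k; fin_cases k <;> rfl
  rw [h2] at h
  have h5 : ((Nat.factorial 2 : ℕ) : A) ≠ 0 := by exact_mod_cast Nat.factorial_ne_zero 2
  rw [Nat.factorial_one, one_mul] at h
  refine mul_left_cancel₀ h5 (h.trans ?_)
  rw [Finset.mul_sum]
  exact Finset.sum_congr rfl fun i _ => by ring

lemma wedge_one_one (θ : M →ₗ[R] A) (β : AlternatingMap R M A (Fin 1)) (v : Fin 2 → M) :
    wedge (oneForm θ) β v = ∑ i : Fin 2, (-1) ^ (i : ℕ) * (θ (v i) * β (i.removeNth v)) := by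
  have h := wedge_U (oneForm θ) β v
  have h2 : U (1+1) (fun w => (oneForm θ) (fun i => w (Fin.castAdd 1 i)) *
      β (fun i => w (Fin.natAdd 1 i))) v =
      ∑ i : Fin 2, (-1) ^ (i : ℕ) * ((1:ℕ).factorial * (θ (v i) * β (i.removeNth v))) := by
    refine (U_succ 1 _ v).trans ?_
    refine Finset.sum_congr rfl fun i _ => ?_
    rw [← U_alt]
    refine congrArg _ (U_congr fun w => congrArg₂ (· * ·) rfl (congrArg _ ?_))
    ext k; fin_cases k <;> rfl
  rw [h2] at h
  simpa using h

lemma removeNth6 (a b c d e f : M) :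
    (Fin.removeNth (0 : Fin 6) ![a,b,c,d,e,f] = ![b,c,d,e,f]) ∧
    (Fin.removeNth (1 : Fin 6) ![a,b,c,d,e,f] = ![a,c,d,e,f]) ∧
    (Fin.removeNth (2 : Fin 6) ![a,b,c,d,e,f] = ![a,b,d,e,f]) ∧
    (Fin.removeNth (3 : Fin 6) ![a,b,c,d,e,f] = ![a,b,c,e,f]) ∧
    (Fin.removeNth (4 : Fin 6) ![a,b,c,d,e,f] = ![a,b,c,d,f]) ∧
    (Fin.removeNth (5 : Fin 6) ![a,b,c,d,e,f] = ![a,b,c,d,e]) := by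
  refine ⟨?_, ?_, ?_, ?_, ?_, ?_⟩ <;> (ext i; fin_cases i <;> rfl)

lemma removeNth5 (a b c d e : M) :
    (Fin.removeNth (0 : Fin 5) ![a,b,c,d,e] = ![b,c,d,e]) ∧
    (Fin.removeNth (1 : Fin 5) ![a,b,c,d,e] = ![a,c,d,e]) ∧
    (Fin.removeNth (2 : Fin 5) ![a,b,c,d,e] = ![a,b,d,e]) ∧
    (Fin.removeNth (3 : Fin 5) ![a,b,c,d,e] = ![a,b,c,e]) ∧
    (Fin.removeNth (4 : Fin 5) ![a,b,c,d,e] = ![a,b,c,d]) := by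
  refine ⟨?_, ?_, ?_, ?_, ?_⟩ <;> (ext i; fin_cases i <;> rfl)

lemma removeNth4 (a b c d : M) :
    (Fin.removeNth (0 : Fin 4) ![a,b,c,d] = ![b,c,d]) ∧
    (Fin.removeNth (1 : Fin 4) ![a,b,c,d] = ![a,c,d]) ∧
    (Fin.removeNth (2 : Fin 4) ![a,b,c,d] = ![a,b,d]) ∧
    (Fin.removeNth (3 : Fin 4) ![a,b,c,d] = ![a,b,c]) := by
  refine ⟨?_, ?_, ?_, ?_⟩ <;> (ext i; fin_cases i <;> rfl)

lemma removeNth3 (a b c : M) :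
    (Fin.removeNth (0 : Fin 3) ![a,b,c] = ![b,c]) ∧
    (Fin.removeNth (1 : Fin 3) ![a,b,c] = ![a,c]) ∧
    (Fin.removeNth (2 : Fin 3) ![a,b,c] = ![a,b]) := by
  refine ⟨?_, ?_, ?_⟩ <;> (ext i; fin_cases i <;> rfl)

lemma removeNth2 (a b : M) :
    (Fin.removeNth (0 : Fin 2) ![a,b] = ![b]) ∧
    (Fin.removeNth (1 : Fin 2) ![a,b] = ![a]) := by
  refine ⟨?_, ?_⟩ <;> (ext i; fin_cases i; rfl)

/-- The wedge of three covectors is a determinant. -/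
lemma wedge_three (ξ η ζ : M →ₗ[R] A) (x y z : M) :
    wedge (oneForm ξ) (wedge (oneForm η) (oneForm ζ)) ![x,y,z] =
      ξ x * (η y * ζ z - η z * ζ y) - ξ y * (η x * ζ z - η z * ζ x)
        + ξ z * (η x * ζ y - η y * ζ x) := by
  have h1 : ∀ a : M, oneForm ζ ![a] = ζ a := fun a => rfl
  have h2 : ∀ a b : M, wedge (oneForm η) (oneForm ζ) ![a,b] = η a * ζ b - η b * ζ a := by
    intro a b
    rw [wedge_one_one]
    simp [Fin.sum_univ_succ, removeNth2, h1]
    ring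
  rw [wedge_one_two]
  obtain ⟨e0, e1, e2⟩ := removeNth3 x y z
  rw [Fin.sum_univ_three, e0, e1, e2]
  erw [h2, h2, h2]
  simp
  ring

lemma swap2 (α : AlternatingMap R M A (Fin 2)) (x y : M) : α ![x,y] = - α ![y,x] := by
  have := α.map_swap ![y,x] (i := 0) (j := 1) (by decide)
  rw [← this]
  congr 1
  ext i; fin_cases i <;> rfl

lemma swap3a (α : AlternatingMap R M A (Fin 3)) (x y z : M) : α ![x,y,z] = - α ![y,x,z] := by
  have := α.map_swap ![y,x,z] (i := 0) (j := 1) (by decide)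
  rw [← this]
  congr 1
  ext i; fin_cases i <;> rfl

lemma swap3b (α : AlternatingMap R M A (Fin 3)) (x y z : M) : α ![x,y,z] = - α ![x,z,y] := by
  have := α.map_swap ![x,z,y] (i := 1) (j := 2) (by decide)
  rw [← this]
  congr 1
  ext i; fin_cases i <;> rfl

lemma same3a (α : AlternatingMap R M A (Fin 3)) (x z : M) : α ![x,x,z] = 0 :=
  α.map_eq_zero_of_eq _ (i := 0) (j := 1) rfl (by decide)

lemma same3b (α : AlternatingMap R M A (Fin 3)) (x z : M) : α ![z,x,x] = 0 :=
  α.map_eq_zero_of_eq _ (i := 1) (j := 2) rfl (by decide)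

lemma same3c (α : AlternatingMap R M A (Fin 3)) (x z : M) : α ![x,z,x] = 0 :=
  α.map_eq_zero_of_eq _ (i := 0) (j := 2) rfl (by decide)

lemma wedge_two_three_s9 (α : AlternatingMap R M A (Fin 2)) (β : AlternatingMap R M A (Fin 3))
    (a b c d e : M) :
    wedge α β ![a,b,c,d,e] =
      α ![a,b] * β ![c,d,e] - α ![a,c] * β ![b,d,e] + α ![a,d] * β ![b,c,e]
      - α ![a,e] * β ![b,c,d] + α ![b,c] * β ![a,d,e] - α ![b,d] * β ![a,c,e]
      + α ![b,e] * β ![a,c,d] + α ![c,d] * β ![a,b,e] - α ![c,e] * β ![a,b,d]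
      + α ![d,e] * β ![a,b,c] := by
  have h := wedge_U α β ![a,b,c,d,e]
  have h2 : U (2+3) (fun w => α (fun i => w (Fin.castAdd 3 i)) * β (fun i => w (Fin.natAdd 2 i)))
      ![a,b,c,d,e] = ∑ i : Fin 5, (-1) ^ (i : ℕ) * ∑ j : Fin 4, (-1) ^ (j : ℕ) *
        ((Nat.factorial 3 : ℕ) * (α ![(![a,b,c,d,e] : Fin 5 → M) i,
          (i.removeNth (![a,b,c,d,e] : Fin 5 → M) : Fin 4 → M) j] *
        β (j.removeNth (i.removeNth (![a,b,c,d,e] : Fin 5 → M) : Fin 4 → M)))) := by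
    refine (U_succ 4 _ _).trans ?_
    refine Finset.sum_congr rfl fun i _ => ?_
    rw [U_succ]
    congr 1
    refine Finset.sum_congr rfl fun j _ => ?_
    rw [← U_alt]
    refine congrArg _ (U_congr fun w => congrArg₂ (· * ·) (congrArg _ ?_) (congrArg _ ?_)) <;>
      (ext k; fin_cases k <;> rfl)
  rw [h2] at h
  have h5 : (((2:ℕ).factorial * (3:ℕ).factorial : ℕ) : A) ≠ 0 := by
    exact_mod_cast Nat.mul_ne_zero (Nat.factorial_ne_zero 2) (Nat.factorial_ne_zero 3)
  refine mul_left_cancel₀ h5 (h.trans ?_)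
  obtain ⟨e0, e1, e2, e3, e4⟩ := removeNth5 a b c d e
  simp only [Fin.sum_univ_five, e0, e1, e2, e3, e4, Fin.sum_univ_four, (removeNth4 _ _ _ _).1,
    (removeNth4 _ _ _ _).2.1, (removeNth4 _ _ _ _).2.2.1, (removeNth4 _ _ _ _).2.2.2]
  simp only [Fin.isValue, Matrix.cons_val, Nat.factorial]
  rw [swap2 α b a, swap2 α c a, swap2 α d a, swap2 α e a, swap2 α c b, swap2 α d b, swap2 α e b,
    swap2 α d c, swap2 α e c, swap2 α e d]
  simp
  ring

lemma wedge_three_three (α β : AlternatingMap R M A (Fin 3)) (a b c d e f : M) :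
    wedge α β ![a,b,c,d,e,f] =
      α ![a,b,c] * β ![d,e,f] - α ![a,b,d] * β ![c,e,f] + α ![a,b,e] * β ![c,d,f] - α ![a,b,f] * β ![c,d,e]
      + α ![a,c,d] * β ![b,e,f] - α ![a,c,e] * β ![b,d,f] + α ![a,c,f] * β ![b,d,e] + α ![a,d,e] * β ![b,c,f]
      - α ![a,d,f] * β ![b,c,e] + α ![a,e,f] * β ![b,c,d] - α ![b,c,d] * β ![a,e,f] + α ![b,c,e] * β ![a,d,f]
      - α ![b,c,f] * β ![a,d,e] - α ![b,d,e] * β ![a,c,f] + α ![b,d,f] * β ![a,c,e] - α ![b,e,f] * β ![a,c,d]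
      + α ![c,d,e] * β ![a,b,f] - α ![c,d,f] * β ![a,b,e] + α ![c,e,f] * β ![a,b,d] - α ![d,e,f] * β ![a,b,c] := by
  have h := wedge_U α β ![a,b,c,d,e,f]
  have h2 : U (3+3) (fun w => α (fun i => w (Fin.castAdd 3 i)) * β (fun i => w (Fin.natAdd 3 i)))
      ![a,b,c,d,e,f] = ∑ i : Fin 6, (-1) ^ (i : ℕ) *
        ((Nat.factorial 2 * Nat.factorial 3 : ℕ) *
          wedge (α.curryLeft ((![a,b,c,d,e,f] : Fin 6 → M) i)) β
          (i.removeNth (![a,b,c,d,e,f] : Fin 6 → M) : Fin 5 → M)) := by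
    refine (U_succ 5 _ _).trans ?_
    refine Finset.sum_congr rfl fun i _ => ?_
    rw [wedge_U]
    refine congrArg _ (U_congr fun w => congrArg₂ (· * ·) (congrArg α ?_) (congrArg _ ?_)) <;>
      (ext k; fin_cases k <;> rfl)
  rw [h2] at h
  have h5 : (((3:ℕ).factorial * (3:ℕ).factorial : ℕ) : A) ≠ 0 := by
    exact_mod_cast Nat.mul_ne_zero (Nat.factorial_ne_zero 3) (Nat.factorial_ne_zero 3)
  refine mul_left_cancel₀ h5 (h.trans ?_)
  obtain ⟨e0, e1, e2, e3, e4, e5⟩ := removeNth6 a b c d e f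
  have hc : ∀ x y z, α.curryLeft x ![y,z] = α ![x,y,z] := fun _ _ _ => rfl
  simp only [Fin.sum_univ_six, e0, e1, e2, e3, e4, e5, wedge_two_three_s9, hc, Matrix.cons_val,
    Fin.isValue, Nat.factorial]
  have r : ∀ x y z, α ![z,x,y] = α ![x,y,z] := fun x y z => by
    rw [swap3a, swap3b, neg_neg]
  rw [swap3a α b a c, swap3a α b a d, swap3a α b a e, swap3a α b a f,
    swap3a α c a d, swap3a α c a e, swap3a α c a f, swap3a α c b d, swap3a α c b e, swap3a α c b f,
    swap3a α d a e, swap3a α d a f, swap3a α d b e, swap3a α d b f, swap3a α d c e, swap3a α d c f,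
    swap3a α e a f, swap3a α e b f, swap3a α e c f, swap3a α e d f,
    r a b c, r a b d, r a b e, r a b f, r a c d, r a c e, r a c f, r a d e, r a d f, r a e f,
    r b c d, r b c e, r b c f, r b d e, r b d f, r b e f, r c d e, r c d f, r c e f, r d e f]
  simp
  ring

end wedges


section coords
variable {W : Type*} [AddCommGroup W] [Module ℝ W] [FiniteDimensional ℝ W]

lemma extend_step (n : ℕ) (v : Fin n → W) (hv : LinearIndependent ℝ v) (k : ℕ)
    (hk : n + k ≤ Module.finrank ℝ W) :
    ∃ w : Fin (n + k) → W, LinearIndependent ℝ w ∧ ∀ i : Fin n, w (Fin.castAdd k i) = v i := by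
  induction k with
  | zero => exact ⟨v, hv, fun i => rfl⟩
  | succ k ih =>
    obtain ⟨w, hw, h⟩ := ih (by omega)
    obtain ⟨x, hx⟩ := exists_linearIndependent_snoc_of_lt_finrank hw (by omega)
    refine ⟨Fin.snoc w x, hx, fun i => ?_⟩
    rw [← h i]
    exact Fin.snoc_castSucc (α := fun _ => W) x w (Fin.castAdd k i)

lemma exists_basis_two (hdim : Module.finrank ℝ W = 6) (y z : W)
    (h : LinearIndependent ℝ ![y,z]) :
    ∃ b : Module.Basis (Fin 6) ℝ W, b 0 = y ∧ b 1 = z := by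
  obtain ⟨w, hw, hh⟩ := extend_step 2 _ h 4 (by omega)
  refine ⟨basisOfLinearIndependentOfCardEqFinrank (b := (w : Fin 6 → W)) hw (by simp [hdim]), ?_, ?_⟩
  · simpa using hh 0
  · simpa using hh 1

lemma exists_basis_one (hdim : Module.finrank ℝ W = 6) (y : W) (h : y ≠ 0) :
    ∃ b : Module.Basis (Fin 6) ℝ W, b 0 = y := by
  obtain ⟨w, hw, hh⟩ := extend_step 1 ![y] (by simpa using h) 5 (by omega)
  refine ⟨basisOfLinearIndependentOfCardEqFinrank (b := (w : Fin 6 → W)) hw (by simp [hdim]), ?_⟩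
  · simpa using hh 0

lemma vol_ne (ε : AlternatingMap ℝ W ℝ (Fin 6)) (hε : ε ≠ 0) (b : Module.Basis (Fin 6) ℝ W) :
    ε b ≠ 0 := fun h => hε ((AlternatingMap.map_basis_eq_zero_iff b ε).1 h)

lemma vec6 (b : Fin 6 → W) : b = ![b 0, b 1, b 2, b 3, b 4, b 5] := by
  ext i; fin_cases i <;> rfl

set_option maxRecDepth 10000 in
lemma wof_aux (θ : W →ₗ[ℝ] ℝ) (β : AlternatingMap ℝ W ℝ (Fin 5)) (v : Fin 6 → W)
    (F : AlternatingMap ℝ W ℝ (Fin 6)) (h : wedge (oneForm θ) β = F) :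
    F v = ∑ i : Fin 6, (-1) ^ (i : ℕ) * (θ (v i) * β (i.removeNth v)) := by
  subst h
  have := wedge_one_five_s9 θ β v
  exact this

lemma coordK_aux (ε : AlternatingMap ℝ W ℝ (Fin 6)) (b : Module.Basis (Fin 6) ℝ W) (i : Fin 6)
    (β : AlternatingMap ℝ W ℝ (Fin 5)) (t : ℝ) (h : wedge (oneForm (b.coord i)) β = t • ε) :
    ε b * t = (-1) ^ (i : ℕ) * β (i.removeNth b : Fin 5 → W) := by
  have h1 := wof_aux (b.coord i) β b _ h
  have h2 : (t • ε) b = t * ε b := rfl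
  rw [mul_comm, ← h2, h1]
  rw [Finset.sum_eq_single i]
  · simp
  · intro j _ hj
    simp [Finsupp.single_apply, hj]
  · simp

lemma coordK (ε : AlternatingMap ℝ W ℝ (Fin 6)) (Ω : AlternatingMap ℝ W ℝ (Fin 3))
    (K : W →ₗ[ℝ] W)
    (hK : ∀ (θ : W →ₗ[ℝ] ℝ) (v : W),
      wedge (oneForm θ) (wedge (Ω.curryLeft v) Ω) = θ (K v) • ε)
    (b : Module.Basis (Fin 6) ℝ W) (i : Fin 6) (x : W) :
    ε b * b.coord i (K x) = (-1) ^ (i : ℕ) * wedge (Ω.curryLeft x) Ω (i.removeNth b : Fin 5 → W) := by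
  refine coordK_aux ε b i _ _ ?_
  exact hK (b.coord i) x

/-- The coefficients of `Ω` in a basis. -/
def cf (Ω : AlternatingMap ℝ W ℝ (Fin 3)) (b : Fin 6 → W) (i j k : Fin 6) : ℝ := Ω ![b i, b j, b k]

/-- the six components of the vector dual to `ι_x Ω ∧ Ω`. -/
def kf {R : Type*} [CommRing R] (A : Fin 6 → Fin 6 → Fin 6 → R) (i j : Fin 6) : R :=
  (-1) ^ (i : ℕ) *
  (let s := fun p => Fin.succAbove i p
   let a := s 0; let b := s 1; let c := s 2; let d := s 3; let e := s 4
   let α := A j; let β := A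
   α a b * β c d e - α a c * β b d e + α a d * β b c e
      - α a e * β b c d + α b c * β a d e - α b d * β a c e
      + α b e * β a c d + α c d * β a b e - α c e * β a b d
      + α d e * β a b c)

lemma coordK_cf (ε : AlternatingMap ℝ W ℝ (Fin 6)) (Ω : AlternatingMap ℝ W ℝ (Fin 3))
    (K : W →ₗ[ℝ] W)
    (hK : ∀ (θ : W →ₗ[ℝ] ℝ) (v : W),
      wedge (oneForm θ) (wedge (Ω.curryLeft v) Ω) = θ (K v) • ε)
    (b : Module.Basis (Fin 6) ℝ W) (i j : Fin 6) :
    ε b * b.coord i (K (b j)) = kf (cf Ω b) i j := by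
  rw [coordK ε Ω K hK]
  have : (i.removeNth b : Fin 5 → W) = ![b (i.succAbove 0), b (i.succAbove 1), b (i.succAbove 2),
    b (i.succAbove 3), b (i.succAbove 4)] := by
    ext k; fin_cases k <;> rfl
  rw [this, wedge_two_three_s9]
  rfl

lemma Kexp (K : W →ₗ[ℝ] W) (b : Module.Basis (Fin 6) ℝ W) (j : Fin 6) :
    K (b j) = ∑ i, b.coord i (K (b j)) • b i := (b.sum_repr (K (b j))).symm

lemma add3 (Ω : AlternatingMap ℝ W ℝ (Fin 3)) (y z : W) :
    ∃ L : W →ₗ[ℝ] ℝ, ∀ x, L x = Ω ![x,y,z] :=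
  ⟨{ toFun := fun x => Ω ![x,y,z]
     map_add' := fun a b => Ω.toMultilinearMap.cons_add ![y,z] a b
     map_smul' := fun a b => Ω.toMultilinearMap.cons_smul ![y,z] a b }, fun _ => rfl⟩

lemma key1 (A : Fin 6 → Fin 6 → Fin 6 → ℝ)
    (h1 : ∀ i j k, j < i → A i j k = - A j i k) (h2 : ∀ i j k, k < j → A i j k = - A i k j)
    (h3 : ∀ i k, A i i k = 0) (h4 : ∀ i k, A k i i = 0) :
    ∑ i, kf A i 0 * A i 0 1 = 0 := by
  have s : ∀ i : Fin 6, (i.succAbove (0 : Fin 5) = if i = 0 then 1 else 0) ∧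
    (i.succAbove (1 : Fin 5) = if i ≤ 1 then 2 else 1) ∧ (i.succAbove (2 : Fin 5) = if i ≤ 2 then 3 else 2)
    ∧ (i.succAbove (3 : Fin 5) = if i ≤ 3 then 4 else 3)
    ∧ (i.succAbove (4 : Fin 5) = if i ≤ 4 then 5 else 4) := by decide
  simp [Fin.sum_univ_six, kf, s, h1, h2, h3, h4]
  ring

lemma key2 (A : Fin 6 → Fin 6 → Fin 6 → ℝ)
    (h1 : ∀ i j k, j < i → A i j k = - A j i k) (h2 : ∀ i j k, k < j → A i j k = - A i k j)
    (h3 : ∀ i k, A i i k = 0) (h4 : ∀ i k, A k i i = 0) :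
    ∑ l, kf A l 0 * kf A 1 l = 0 := by
  have s : ∀ i : Fin 6, (i.succAbove (0 : Fin 5) = if i = 0 then 1 else 0) ∧
    (i.succAbove (1 : Fin 5) = if i ≤ 1 then 2 else 1) ∧ (i.succAbove (2 : Fin 5) = if i ≤ 2 then 3 else 2)
    ∧ (i.succAbove (3 : Fin 5) = if i ≤ 3 then 4 else 3)
    ∧ (i.succAbove (4 : Fin 5) = if i ≤ 4 then 5 else 4) := by decide
  simp [Fin.sum_univ_six, kf, s, h1, h2, h3, h4]
  ring

end coords


section normal
variable {W : Type*} [AddCommGroup W] [Module ℝ W] [FiniteDimensional ℝ W]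

def gz (m : Fin 3) (i : Fin 6) : GaussianInt :=
  if (i : ℕ) = m then 1 else if (i : ℕ) = m + 3 then ⟨0, 1⟩ else 0

def gdet (i j k : Fin 6) : GaussianInt :=
  gz 0 i * (gz 1 j * gz 2 k - gz 1 k * gz 2 j) - gz 0 j * (gz 1 i * gz 2 k - gz 1 k * gz 2 i)
        + gz 0 k * (gz 1 i * gz 2 j - gz 1 j * gz 2 i)

def gre (i j k : Fin 6) : ℤ := (gdet i j k).re
def gim (i j k : Fin 6) : ℤ := (gdet i j k).im

def mz (i j : Fin 6) : ℤ :=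
  if (i : ℕ) = j + 3 then -1 else if (j : ℕ) = i + 3 then 1 else 0

def w33 {R : Type*} [CommRing R] (α β : Fin 6 → Fin 6 → Fin 6 → R) : R :=
  α 0 1 2 * β 3 4 5 - α 0 1 3 * β 2 4 5 + α 0 1 4 * β 2 3 5 - α 0 1 5 * β 2 3 4
      + α 0 2 3 * β 1 4 5 - α 0 2 4 * β 1 3 5 + α 0 2 5 * β 1 3 4 + α 0 3 4 * β 1 2 5
      - α 0 3 5 * β 1 2 4 + α 0 4 5 * β 1 2 3 - α 1 2 3 * β 0 4 5 + α 1 2 4 * β 0 3 5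
      - α 1 2 5 * β 0 3 4 - α 1 3 4 * β 0 2 5 + α 1 3 5 * β 0 2 4 - α 1 4 5 * β 0 2 3
      + α 2 3 4 * β 0 1 5 - α 2 3 5 * β 0 1 4 + α 2 4 5 * β 0 1 3 - α 3 4 5 * β 0 1 2

lemma gz_wedge : w33 gre gim = -4 := by decide

lemma gz_K : ∀ i j, kf gre i j = -2 * mz i j := by decide

lemma mz_sq : ∀ i j, ∑ l, mz l j * mz i l = if i = j then -1 else 0 := by decide

lemma mz_gz : ∀ m j, ∑ l, (mz l j : GaussianInt) * gz m l = ⟨0, -1⟩ * gz m j := by decide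
end normal

section structureK
variable {W : Type*} [AddCommGroup W] [Module ℝ W] [FiniteDimensional ℝ W]

lemma form_zero (Ω : AlternatingMap ℝ W ℝ (Fin 3)) (y z : W) : Ω ![0,y,z] = 0 :=
  Ω.map_coord_zero (i := 0) rfl

lemma key1_cf (Ω : AlternatingMap ℝ W ℝ (Fin 3)) (b : Fin 6 → W) :
    ∑ i, kf (cf Ω b) i 0 * Ω ![b i, b 0, b 1] = 0 :=
  key1 (cf Ω b) (fun _ _ _ _ => swap3a _ _ _ _) (fun _ _ _ _ => swap3b _ _ _ _)
    (fun _ _ => same3a _ _ _) (fun _ _ => same3b _ _ _)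

lemma key2_cf (Ω : AlternatingMap ℝ W ℝ (Fin 3)) (b : Fin 6 → W) :
    ∑ l, kf (cf Ω b) l 0 * kf (cf Ω b) 1 l = 0 :=
  key2 (cf Ω b) (fun _ _ _ _ => swap3a _ _ _ _) (fun _ _ _ _ => swap3b _ _ _ _)
    (fun _ _ => same3a _ _ _) (fun _ _ => same3b _ _ _)

lemma slot1_smul (Ω : AlternatingMap ℝ W ℝ (Fin 3)) (t : ℝ) (x y z : W) :
    Ω ![t • x, y, z] = t * Ω ![x,y,z] := by
  obtain ⟨L, hL⟩ := add3 Ω y z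
  rw [← hL, ← hL]; simp

lemma slot1_add (Ω : AlternatingMap ℝ W ℝ (Fin 3)) (x x' y z : W) :
    Ω ![x + x', y, z] = Ω ![x,y,z] + Ω ![x',y,z] := by
  obtain ⟨L, hL⟩ := add3 Ω y z
  rw [← hL, ← hL, ← hL]; simp

lemma K_same (hdim : Module.finrank ℝ W = 6)
    (ε : AlternatingMap ℝ W ℝ (Fin 6)) (hε : ε ≠ 0) (Ω : AlternatingMap ℝ W ℝ (Fin 3))
    (K : W →ₗ[ℝ] W)
    (hK : ∀ (θ : W →ₗ[ℝ] ℝ) (v : W),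
      wedge (oneForm θ) (wedge (Ω.curryLeft v) Ω) = θ (K v) • ε) (y z : W) :
    Ω ![K y, y, z] = 0 := by
  by_cases h : LinearIndependent ℝ ![y,z]
  · obtain ⟨b, rfl, rfl⟩ := exists_basis_two hdim y z h
    have h0 := vol_ne ε hε b
    obtain ⟨L, hL⟩ := add3 Ω (b 0) (b 1)
    have : ε b * Ω ![K (b 0), b 0, b 1] = 0 := by
      rw [← hL, Kexp K b 0, map_sum, Finset.mul_sum, ← key1_cf Ω b]
      refine Finset.sum_congr rfl fun i _ => ?_
      rw [map_smul, smul_eq_mul, ← mul_assoc, coordK_cf ε Ω K hK, hL]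
    exact (mul_eq_zero.1 this).resolve_left h0
  · by_cases hy : y = 0
    · subst hy; rw [map_zero, form_zero]
    · rw [LinearIndependent.pair_iff' hy] at h
      push Not at h
      obtain ⟨a, rfl⟩ := h
      rw [swap3b, swap3a, slot1_smul, swap3a, same3b]; simp

lemma K_comm1 (hdim : Module.finrank ℝ W = 6)
    (ε : AlternatingMap ℝ W ℝ (Fin 6)) (hε : ε ≠ 0) (Ω : AlternatingMap ℝ W ℝ (Fin 3))
    (K : W →ₗ[ℝ] W)
    (hK : ∀ (θ : W →ₗ[ℝ] ℝ) (v : W),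
      wedge (oneForm θ) (wedge (Ω.curryLeft v) Ω) = θ (K v) • ε) (x y z : W) :
    Ω ![K x, y, z] = - Ω ![K y, x, z] := by
  have h := K_same hdim ε hε Ω K hK (x + y) z
  have hx := K_same hdim ε hε Ω K hK x z
  have hy := K_same hdim ε hε Ω K hK y z
  rw [swap3a, slot1_add, swap3a Ω x, swap3a Ω y, map_add, slot1_add, slot1_add, hx, hy] at h
  linarith

lemma exists_prime (hdim : Module.finrank ℝ W = 6)
    (ε : AlternatingMap ℝ W ℝ (Fin 6)) (hε : ε ≠ 0) (Ω : AlternatingMap ℝ W ℝ (Fin 3))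
    (K : W →ₗ[ℝ] W)
    (hK : ∀ (θ : W →ₗ[ℝ] ℝ) (v : W),
      wedge (oneForm θ) (wedge (Ω.curryLeft v) Ω) = θ (K v) • ε) :
    ∃ Ω' : AlternatingMap ℝ W ℝ (Fin 3), ∀ x y z, Ω' ![x,y,z] = Ω ![K x, y, z] := by
  refine ⟨(1/3 : ℝ) • AlternatingMap.alternatizeUncurryFin (AlternatingMap.curryLeft Ω ∘ₗ K), ?_⟩
  intro x y z
  have h := AlternatingMap.alternatizeUncurryFin_apply (AlternatingMap.curryLeft Ω ∘ₗ K) ![x,y,z]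
  rw [AlternatingMap.smul_apply, h]
  have e : ∀ a b c, ((AlternatingMap.curryLeft Ω ∘ₗ K) a) ![b,c] = Ω ![K a, b, c] := fun a b c => rfl
  rw [Fin.sum_univ_three, (removeNth3 x y z).1, (removeNth3 x y z).2.1, (removeNth3 x y z).2.2]
  simp only [Matrix.cons_val, e]
  have h1 := K_comm1 hdim ε hε Ω K hK x y z
  have h2 := K_comm1 hdim ε hε Ω K hK z x y
  have h3 := swap3b Ω (K x) y z
  simp
  linarith

lemma K_sq (hdim : Module.finrank ℝ W = 6)
    (ε : AlternatingMap ℝ W ℝ (Fin 6)) (hε : ε ≠ 0) (Ω : AlternatingMap ℝ W ℝ (Fin 3))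
    (K : W →ₗ[ℝ] W)
    (hK : ∀ (θ : W →ₗ[ℝ] ℝ) (v : W),
      wedge (oneForm θ) (wedge (Ω.curryLeft v) Ω) = θ (K v) • ε) :
    ∃ μ : ℝ, K ∘ₗ K = μ • LinearMap.id := by
  refine LinearMap.exists_eq_smul_id_of_forall_notLinearIndependent ?_
  intro y h
  obtain ⟨b, h0, h1⟩ := exists_basis_two hdim y _ h
  have hb := vol_ne ε hε b
  have e1 : b.coord 1 (K (K (b 0))) = 1 := by
    have : K (K (b 0)) = b 1 := by rw [h0, h1]; rfl
    rw [this]; simp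
  have e2 : ε b * (ε b * b.coord 1 (K (K (b 0)))) = 0 := by
    rw [Kexp K b 0, map_sum, map_sum, Finset.mul_sum, Finset.mul_sum, ← key2_cf Ω b]
    refine Finset.sum_congr rfl fun i _ => ?_
    rw [map_smul, map_smul, smul_eq_mul, ← coordK_cf ε Ω K hK, ← coordK_cf ε Ω K hK]
    ring
  rw [e1] at e2
  simp [hb] at e2

lemma trace_sq (hdim : Module.finrank ℝ W = 6) (K : W →ₗ[ℝ] W) (μ : ℝ)
    (h : K ∘ₗ K = μ • LinearMap.id) : (6 : ℝ)⁻¹ * LinearMap.trace ℝ W (K ∘ₗ K) = μ := by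
  rw [h, map_smul, LinearMap.trace_id, hdim]
  simp; ring
end structureK

section normalform
variable {W : Type*} [AddCommGroup W] [Module ℝ W] [FiniteDimensional ℝ W]

lemma nf_basis (hdim : Module.finrank ℝ W = 6) (ξ : Fin 3 → W →ₗ[ℝ] ℂ)
    (hinj : ∀ v, (∀ m, ξ m v = 0) → v = 0) :
    ∃ b : Module.Basis (Fin 6) ℝ W, ∀ m i, ξ m (b i) = GaussianInt.toComplex (gz m i) := by
  let Φ : W →ₗ[ℝ] (Fin 6 → ℝ) := LinearMap.pi
    ![Complex.reLm ∘ₗ ξ 0, Complex.reLm ∘ₗ ξ 1, Complex.reLm ∘ₗ ξ 2,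
      Complex.imLm ∘ₗ ξ 0, Complex.imLm ∘ₗ ξ 1, Complex.imLm ∘ₗ ξ 2]
  have h0 : ∀ v, Φ v 0 = (ξ 0 v).re := fun v => rfl
  have h1 : ∀ v, Φ v 1 = (ξ 1 v).re := fun v => rfl
  have h2 : ∀ v, Φ v 2 = (ξ 2 v).re := fun v => rfl
  have h3 : ∀ v, Φ v 3 = (ξ 0 v).im := fun v => rfl
  have h4 : ∀ v, Φ v 4 = (ξ 1 v).im := fun v => rfl
  have h5 : ∀ v, Φ v 5 = (ξ 2 v).im := fun v => rfl
  have hi : Function.Injective Φ := by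
    rw [← LinearMap.ker_eq_bot, LinearMap.ker_eq_bot']
    intro v hv
    refine hinj v fun m => ?_
    have hv' : ∀ i, Φ v i = 0 := fun i => by rw [hv]; rfl
    fin_cases m
    · exact Complex.ext ((h0 v).symm.trans (hv' 0)) ((h3 v).symm.trans (hv' 3))
    · exact Complex.ext ((h1 v).symm.trans (hv' 1)) ((h4 v).symm.trans (hv' 4))
    · exact Complex.ext ((h2 v).symm.trans (hv' 2)) ((h5 v).symm.trans (hv' 5))
  let e := LinearEquiv.ofInjectiveOfFinrankEq Φ hi (by simp [hdim])
  let b := Module.Basis.ofEquivFun e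
  have hb : ∀ i j, Φ (b i) j = if j = i then 1 else 0 := by
    intro i j
    have h : e (b i) = Pi.single i 1 := by simp [b]
    have h' : Φ (b i) = Pi.single i 1 := h
    rw [h', Pi.single_apply]
  refine ⟨b, fun m i => ?_⟩
  apply Complex.ext
  · rw [← GaussianInt.intCast_re]
    fin_cases m
    · refine (h0 (b i)).symm.trans ((hb i 0).trans ?_)
      fin_cases i <;> simp [gz]
    · refine (h1 (b i)).symm.trans ((hb i 1).trans ?_)
      fin_cases i <;> simp [gz]
    · refine (h2 (b i)).symm.trans ((hb i 2).trans ?_)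
      fin_cases i <;> simp [gz]
  · rw [← GaussianInt.intCast_im]
    fin_cases m
    · refine (h3 (b i)).symm.trans ((hb i 3).trans ?_)
      fin_cases i <;> simp [gz]
    · refine (h4 (b i)).symm.trans ((hb i 4).trans ?_)
      fin_cases i <;> simp [gz]
    · refine (h5 (b i)).symm.trans ((hb i 5).trans ?_)
      fin_cases i <;> simp [gz]

lemma cxI_apply (Ω Ωh : AlternatingMap ℝ W ℝ (Fin 3)) (v : Fin 3 → W) :
    (cx Ω + Complex.I • cx Ωh) v = ⟨Ω v, Ωh v⟩ := by
  have : (cx Ω + Complex.I • cx Ωh) v = (Ω v : ℂ) + Complex.I * (Ωh v : ℂ) := rfl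
  rw [this]
  apply Complex.ext <;> simp

set_option maxRecDepth 10000 in
lemma w33_aux (Ω Ωh : AlternatingMap ℝ W ℝ (Fin 3)) (b : Fin 6 → W)
    (F : AlternatingMap ℝ W ℝ (Fin 6)) (h : wedge Ω Ωh = F) :
    F b = w33 (cf Ω b) (cf Ωh b) := by
  subst h
  have := wedge_three_three Ω Ωh (b 0) (b 1) (b 2) (b 3) (b 4) (b 5)
  rw [vec6 b]
  exact this

lemma wedge_eq_smul (ε : AlternatingMap ℝ W ℝ (Fin 6)) (hε : ε ≠ 0)
    (b : Module.Basis (Fin 6) ℝ W) (F : AlternatingMap ℝ W ℝ (Fin 6)) :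
    F = (F b / ε b) • ε := by
  have h0 := vol_ne ε hε b
  rw [← sub_eq_zero, ← AlternatingMap.map_basis_eq_zero_iff b]
  simp
  field_simp
  simp

lemma kf_cast (A : Fin 6 → Fin 6 → Fin 6 → ℤ) (i j : Fin 6) :
    kf (fun i j k => (A i j k : ℝ)) i j = ((kf A i j : ℤ) : ℝ) := by
  simp [kf]

lemma w33_cast (A B : Fin 6 → Fin 6 → Fin 6 → ℤ) :
    w33 (fun i j k => (A i j k : ℝ)) (fun i j k => (B i j k : ℝ)) = ((w33 A B : ℤ) : ℝ) := by
  simp [w33]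

lemma nf_main (hdim : Module.finrank ℝ W = 6)
    (ε : AlternatingMap ℝ W ℝ (Fin 6)) (hε : ε ≠ 0) (Ω Ωh : AlternatingMap ℝ W ℝ (Fin 3))
    (K : W →ₗ[ℝ] W)
    (hK : ∀ (θ : W →ₗ[ℝ] ℝ) (v : W),
      wedge (oneForm θ) (wedge (Ω.curryLeft v) Ω) = θ (K v) • ε)
    (ξ : Fin 3 → W →ₗ[ℝ] ℂ)
    (hinj : ∀ v, (∀ m, ξ m v = 0) → v = 0)
    (hdec : cx Ω + Complex.I • cx Ωh =
      wedge (oneForm (ξ 0)) (wedge (oneForm (ξ 1)) (oneForm (ξ 2)))) :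
    ∃ c : ℝ, wedge Ω Ωh = c • ε ∧ (∀ x y z, Ω ![K x,y,z] = c / 2 * Ωh ![x,y,z]) ∧
      K ∘ₗ K = (-(c/2)^2) • LinearMap.id := by
  obtain ⟨b, hb⟩ := nf_basis hdim ξ hinj
  have h0 := vol_ne ε hε b
  have hdet : ∀ x y z, (⟨Ω ![x,y,z], Ωh ![x,y,z]⟩ : ℂ) =
      ξ 0 x * (ξ 1 y * ξ 2 z - ξ 1 z * ξ 2 y) - ξ 0 y * (ξ 1 x * ξ 2 z - ξ 1 z * ξ 2 x)
        + ξ 0 z * (ξ 1 x * ξ 2 y - ξ 1 y * ξ 2 x) := by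
    intro x y z
    rw [← cxI_apply, hdec]
    exact wedge_three _ _ _ _ _ _
  have hg : ∀ i j k, (⟨cf Ω b i j k, cf Ωh b i j k⟩ : ℂ) = GaussianInt.toComplex (gdet i j k) := by
    intro i j k
    refine (hdet _ _ _).trans ?_
    simp only [hb, gdet, map_add, map_sub, map_mul]
  have hre : cf Ω b = fun i j k => (gre i j k : ℝ) := by
    ext i j k
    have := congrArg Complex.re (hg i j k)
    rwa [← GaussianInt.intCast_re] at this
  have him : cf Ωh b = fun i j k => (gim i j k : ℝ) := by
    ext i j k
    have := congrArg Complex.im (hg i j k)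
    rwa [← GaussianInt.intCast_im] at this
  have hKc : ∀ i j, b.coord i (K (b j)) = (-2 / ε b) * (mz i j : ℝ) := by
    intro i j
    have := coordK_cf ε Ω K hK b i j
    rw [hre, kf_cast, gz_K] at this
    push_cast at this
    field_simp
    linarith
  have hKb : ∀ j, K (b j) = ∑ i, ((-2 / ε b) * (mz i j : ℝ)) • b i := by
    intro j
    rw [Kexp K b j]
    simp only [hKc]
  have hξ : ∀ m x, ξ m (K x) = Complex.I * (2 / ε b : ℝ) * ξ m x := by
    intro m
    suffices h : ξ m ∘ₗ K = (Complex.I * (2 / ε b : ℝ)) • ξ m from fun x => LinearMap.congr_fun h x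
    refine b.ext fun j => ?_
    have := congrArg GaussianInt.toComplex (mz_gz m j)
    simp only [map_sum, map_mul, ← hb, map_intCast] at this
    simp only [LinearMap.comp_apply, hKb, map_sum, map_smul, LinearMap.smul_apply, smul_eq_mul]
    have e : ∀ i, ((-2 / ε b) * (mz i j : ℝ)) • (ξ m) (b i) =
      ((-2 / ε b : ℝ) : ℂ) * ((mz i j : ℂ) * ξ m (b i)) := by
      intro i
      rw [Complex.real_smul]; push_cast; ring
    simp only [e, ← Finset.mul_sum, this]
    have : GaussianInt.toComplex ⟨0, -1⟩ = - Complex.I := by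
      apply Complex.ext <;> simp
    rw [this]
    push_cast
    ring
  refine ⟨-4 / ε b, ?_, ?_, ?_⟩
  · have h1 := wedge_eq_smul ε hε b (wedge Ω Ωh)
    have h2 := w33_aux Ω Ωh b _ rfl
    rw [hre, him, w33_cast, gz_wedge] at h2
    refine h1.trans ?_
    rw [h2]
    norm_num
  · intro x y z
    have h1 := hdet (K x) y z
    simp only [hξ] at h1
    have h2 : (⟨Ω ![K x,y,z], Ωh ![K x,y,z]⟩ : ℂ) =
      Complex.I * (2 / ε b : ℝ) * ⟨Ω ![x,y,z], Ωh ![x,y,z]⟩ := by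
      rw [h1, hdet x y z]; ring
    have := congrArg Complex.re h2
    simp at this
    rw [this]; ring
  · refine LinearMap.ext fun x => ?_
    rw [← sub_eq_zero]
    refine hinj _ fun m => ?_
    rw [map_sub]
    simp only [LinearMap.comp_apply, hξ, LinearMap.smul_apply, map_smul, LinearMap.id_apply,
      Complex.real_smul]
    push_cast
    linear_combination (4 / (ε b : ℂ)^2 * ξ m x) * Complex.I_mul_I
end normalform

section existence
variable {W : Type*} [AddCommGroup W] [Module ℝ W] [FiniteDimensional ℝ W]

lemma add3C (α : AlternatingMap ℝ W ℂ (Fin 3)) (y z : W) :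
    ∃ L : W →ₗ[ℝ] ℂ, ∀ x, L x = α ![x,y,z] :=
  ⟨{ toFun := fun x => α ![x,y,z]
     map_add' := fun a b => α.toMultilinearMap.cons_add ![y,z] a b
     map_smul' := fun a b => α.toMultilinearMap.cons_smul ![y,z] a b }, fun _ => rfl⟩

lemma ext3_s9 {A : Type*} [AddCommGroup A] [Module ℝ A] (α β : AlternatingMap ℝ W A (Fin 3))
    (h : ∀ x y z, α ![x,y,z] = β ![x,y,z]) : α = β := by
  ext v
  have : v = ![v 0, v 1, v 2] := by ext i; fin_cases i <;> rfl
  rw [this]; exact h _ _ _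

lemma decomp_of_eigen (hdim : Module.finrank ℝ W = 6) (K : W →ₗ[ℝ] W) (s : ℝ) (hs : 0 < s)
    (α : AlternatingMap ℝ W ℂ (Fin 3)) (hα : α ≠ 0)
    (hKα : ∀ x y z, α ![K x, y, z] = -(Complex.I * s) * α ![x,y,z]) :
    ∃ ξ : Fin 3 → W →ₗ[ℝ] ℂ, (∀ v, (∀ m, ξ m v = 0) → v = 0) ∧
      α = wedge (oneForm (ξ 0)) (wedge (oneForm (ξ 1)) (oneForm (ξ 2))) := by
  have : ∃ e1 e2 e3, α ![e1,e2,e3] ≠ 0 := by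
    by_contra! h
    exact hα (ext3_s9 _ _ fun x y z => by simp [h x y z])
  obtain ⟨e1, e2, e3, ha⟩ := this
  set a := α ![e1,e2,e3] with hadef
  have h231 : α ![e2,e3,e1] = a := by rw [swap3b, swap3a, neg_neg]
  have h312 : α ![e3,e1,e2] = a := by rw [swap3a, swap3b, neg_neg]
  have h213 : α ![e2,e1,e3] = -a := by rw [swap3a]
  have h132 : α ![e1,e3,e2] = -a := by rw [swap3b]
  have h321 : α ![e3,e2,e1] = -a := by rw [swap3a, h231]
  obtain ⟨L1, hL1⟩ := add3C α e2 e3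
  obtain ⟨L2, hL2⟩ := add3C α e3 e1
  obtain ⟨L3, hL3⟩ := add3C α e1 e2
  have hc : (s : ℂ) ≠ 0 := by exact_mod_cast hs.ne'
  let Z : Fin 3 → W →ₗ[ℝ] ℂ := ![a⁻¹ • L1, a⁻¹ • L2, a⁻¹ • L3]
  have z1 : ∀ x, Z 0 x = a⁻¹ * α ![x,e2,e3] := fun x => by rw [← hL1]; rfl
  have z2 : ∀ x, Z 1 x = a⁻¹ * α ![x,e3,e1] := fun x => by rw [← hL2]; rfl
  have z3 : ∀ x, Z 2 x = a⁻¹ * α ![x,e1,e2] := fun x => by rw [← hL3]; rfl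
  have zK : ∀ m x, Z m (K x) = -(Complex.I * s) * Z m x := by
    intro m x
    fin_cases m
    · refine (z1 _).trans ((?_ : _ = _).trans (congrArg _ (z1 x).symm))
      rw [hKα]; ring
    · refine (z2 _).trans ((?_ : _ = _).trans (congrArg _ (z2 x).symm))
      rw [hKα]; ring
    · refine (z3 _).trans ((?_ : _ = _).trans (congrArg _ (z3 x).symm))
      rw [hKα]; ring
  let q : (Fin 3 → ℂ) → W := fun w =>
    (w 0).re • e1 + (w 1).re • e2 + (w 2).re • e3
      - (s⁻¹ * (w 0).im) • K e1 - (s⁻¹ * (w 1).im) • K e2 - (s⁻¹ * (w 2).im) • K e3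
  have hq : ∀ (L : W →ₗ[ℝ] ℂ), (∀ x, L (K x) = -(Complex.I * s) * L x) → ∀ w,
      L (q w) = w 0 * L e1 + w 1 * L e2 + w 2 * L e3 := by
    intro L hL w
    simp only [q, map_add, map_sub, map_smul, hL, Complex.real_smul]
    conv_rhs => rw [← Complex.re_add_im (w 0), ← Complex.re_add_im (w 1), ← Complex.re_add_im (w 2)]
    push_cast
    field_simp
    ring
  let Ψ : W →ₗ[ℝ] (Fin 3 → ℂ) := LinearMap.pi Z
  have hsurj : Function.Surjective Ψ := by
    intro w
    refine ⟨q w, ?_⟩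
    ext m
    have h := hq (Z m) (zK m) w
    refine h.trans ?_
    fin_cases m
    · change w 0 * Z 0 e1 + w 1 * Z 0 e2 + w 2 * Z 0 e3 = w 0
      rw [z1, z1, z1, same3a, same3c, ← hadef]; field_simp; ring
    · change w 0 * Z 1 e1 + w 1 * Z 1 e2 + w 2 * Z 1 e3 = w 1
      rw [z2, z2, z2, same3a, same3c, h231]; field_simp; ring
    · change w 0 * Z 2 e1 + w 1 * Z 2 e2 + w 2 * Z 2 e3 = w 2
      rw [z3, z3, z3, same3a, same3c, h312]; field_simp; ring
  have hinj : Function.Injective Ψ := by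
    refine (LinearMap.injective_iff_surjective_of_finrank_eq_finrank ?_).2 hsurj
    rw [hdim, Module.finrank_pi_fintype]
    simp [Complex.finrank_real_complex]
  have hexp : ∀ x, q (Ψ x) = x := by
    intro x
    apply hinj
    ext m
    have h := hq (Z m) (zK m) (Ψ x)
    refine h.trans ?_
    fin_cases m
    · change Ψ x 0 * Z 0 e1 + Ψ x 1 * Z 0 e2 + Ψ x 2 * Z 0 e3 = Ψ x 0
      rw [z1, z1, z1, same3a, same3c, ← hadef]; field_simp; ring
    · change Ψ x 0 * Z 1 e1 + Ψ x 1 * Z 1 e2 + Ψ x 2 * Z 1 e3 = Ψ x 1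
      rw [z2, z2, z2, same3a, same3c, h231]; field_simp; ring
    · change Ψ x 0 * Z 2 e1 + Ψ x 1 * Z 2 e2 + Ψ x 2 * Z 2 e3 = Ψ x 2
      rw [z3, z3, z3, same3a, same3c, h312]; field_simp; ring
  have hslot : ∀ x y z, α ![x,y,z] =
      Z 0 x * α ![e1,y,z] + Z 1 x * α ![e2,y,z] + Z 2 x * α ![e3,y,z] := by
    intro x y z
    obtain ⟨L, hL⟩ := add3C α y z
    have h := hq L (fun x => by rw [hL, hL, hKα]) (Ψ x)
    rw [hexp] at h
    rw [← hL, ← hL, ← hL, ← hL]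
    exact h
  have hslot2 : ∀ x y z, α ![x,y,z] =
      Z 0 y * α ![x,e1,z] + Z 1 y * α ![x,e2,z] + Z 2 y * α ![x,e3,z] := by
    intro x y z
    rw [swap3a, hslot y x z, swap3a α x e1, swap3a α x e2, swap3a α x e3]; ring
  have hslot3 : ∀ x y z, α ![x,y,z] =
      Z 0 z * α ![x,y,e1] + Z 1 z * α ![x,y,e2] + Z 2 z * α ![x,y,e3] := by
    intro x y z
    rw [swap3b, hslot2 x z y, swap3b α x y e1, swap3b α x y e2, swap3b α x y e3]; ring
  refine ⟨![a • Z 0, Z 1, Z 2], ?_, ?_⟩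
  · intro v hv
    apply hinj
    rw [map_zero]
    ext m
    change Z m v = 0
    fin_cases m
    · have h : a * Z 0 v = 0 := hv 0
      exact (mul_eq_zero.1 h).resolve_left ha
    · exact hv 1
    · exact hv 2
  · refine ext3_s9 _ _ fun x y z => ?_
    have h := wedge_three (a • Z 0) (Z 1) (Z 2) x y z
    refine Eq.trans ?_ h.symm
    rw [hslot x y z, hslot2 e1 y z, hslot2 e2 y z, hslot2 e3 y z]
    rw [hslot3 e1 e2 z, hslot3 e1 e3 z, hslot3 e2 e1 z, hslot3 e2 e3 z, hslot3 e3 e1 z, hslot3 e3 e2 z]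
    simp only [same3a, same3b, same3c, h231, h312, h213, h132, h321, ← hadef, LinearMap.smul_apply,
      smul_eq_mul]
    ring
end existence

section final
variable {W : Type*} [AddCommGroup W] [Module ℝ W] [FiniteDimensional ℝ W]

lemma w33_neg_swap (Ω Ωh : AlternatingMap ℝ W ℝ (Fin 3)) (b : Fin 6 → W) :
    w33 (cf Ωh b) (cf (-Ω) b) = w33 (cf Ω b) (cf Ωh b) := by
  have h : ∀ i j k, cf (-Ω) b i j k = - cf Ω b i j k := fun i j k => rfl
  simp only [w33, h]
  ring

lemma smul_inj (ε : AlternatingMap ℝ W ℝ (Fin 6)) (hε : ε ≠ 0) (c c' : ℝ)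
    (F : AlternatingMap ℝ W ℝ (Fin 6)) (h : F = c • ε) (h' : F = c' • ε) : c = c' :=
  smul_left_injective ℝ hε (h.symm.trans h')

lemma wedge_coeff_swap (hdim : Module.finrank ℝ W = 6)
    (ε : AlternatingMap ℝ W ℝ (Fin 6)) (hε : ε ≠ 0) (Ω Ωh : AlternatingMap ℝ W ℝ (Fin 3))
    (c c' : ℝ) (h : wedge Ω Ωh = c • ε) (h' : wedge Ωh (-Ω) = c' • ε) : c' = c := by
  have b : Module.Basis (Fin 6) ℝ W := Module.finBasisOfFinrankEq ℝ W hdim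
  have h1 := w33_aux Ω Ωh b _ h
  have h2 := w33_aux Ωh (-Ω) b _ h'
  rw [w33_neg_swap, ← h1] at h2
  have h0 := vol_ne ε hε b
  have h3 : c' * ε b = c * ε b := h2
  exact mul_right_cancel₀ h0 h3

lemma inj_of_wedge (hdim : Module.finrank ℝ W = 6)
    (ε : AlternatingMap ℝ W ℝ (Fin 6)) (hε : ε ≠ 0) (Ω Ωh : AlternatingMap ℝ W ℝ (Fin 3))
    (c : ℝ) (hc : c ≠ 0) (h : wedge Ω Ωh = c • ε) (ξ : Fin 3 → W →ₗ[ℝ] ℂ)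
    (hdec : cx Ω + Complex.I • cx Ωh =
      wedge (oneForm (ξ 0)) (wedge (oneForm (ξ 1)) (oneForm (ξ 2)))) :
    ∀ v, (∀ m, ξ m v = 0) → v = 0 := by
  intro v hv
  by_contra hne
  obtain ⟨b, rfl⟩ := exists_basis_one hdim v hne
  have hd : ∀ y z, (⟨Ω ![b 0,y,z], Ωh ![b 0,y,z]⟩ : ℂ) = 0 := by
    intro y z
    rw [← cxI_apply, hdec]
    refine (wedge_three _ _ _ _ _ _).trans ?_
    simp [hv]
  have h1 : ∀ j k, cf Ω b 0 j k = 0 := fun j k => congrArg Complex.re (hd (b j) (b k))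
  have h2 : ∀ j k, cf Ωh b 0 j k = 0 := fun j k => congrArg Complex.im (hd (b j) (b k))
  have h3 := w33_aux Ω Ωh b _ h
  have h4 : w33 (cf Ω b) (cf Ωh b) = 0 := by simp [w33, h1, h2]
  rw [h4] at h3
  have h5 : c * ε b = 0 := h3
  exact (mul_ne_zero hc (vol_ne ε hε b)) h5

end final

/-- If `λ(Ω) < 0` there is a unique real 3-form `Ω̂` such
that `Ω + iΩ̂` is a decomposable complex 3-form on `W ⊗ ℂ` and `Ω ∧ Ω̂` is a
positive multiple of `ε`; moreover `Ω ∧ Ω̂ = 2√(−λ(Ω))·ε`, `λ(Ω̂) = λ(Ω)`,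
and applying the same construction to `Ω̂` yields `−Ω` (the hat operation
squares to minus the identity). -/
theorem stmt9 (W : Type*) [AddCommGroup W] [Module ℝ W] [FiniteDimensional ℝ W]
    (hdim : Module.finrank ℝ W = 6)
    (ε : AlternatingMap ℝ W ℝ (Fin 6)) (hε : ε ≠ 0)
    (K : AlternatingMap ℝ W ℝ (Fin 3) → W →ₗ[ℝ] W)
    (hK : ∀ (Ω : AlternatingMap ℝ W ℝ (Fin 3)) (θ : W →ₗ[ℝ] ℝ) (v : W),
      wedge (oneForm θ) (wedge (Ω.curryLeft v) Ω) = θ (K Ω v) • ε)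
    (lam : AlternatingMap ℝ W ℝ (Fin 3) → ℝ)
    (hlam : ∀ Ω, lam Ω = (6 : ℝ)⁻¹ * LinearMap.trace ℝ W (K Ω ∘ₗ K Ω))
    (Ω : AlternatingMap ℝ W ℝ (Fin 3)) (hΩ : lam Ω < 0) :
    ∃ Ωhat : AlternatingMap ℝ W ℝ (Fin 3),
      (IsDecomposable (cx Ω + Complex.I • cx Ωhat) ∧
          (∃ c : ℝ, 0 < c ∧ wedge Ω Ωhat = c • ε) ∧
          wedge Ω Ωhat = (2 * Real.sqrt (-lam Ω)) • ε ∧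
          lam Ωhat = lam Ω ∧
          IsDecomposable (cx Ωhat + Complex.I • cx (-Ω)) ∧
          (∃ c : ℝ, 0 < c ∧ wedge Ωhat (-Ω) = c • ε)) ∧
      ∀ Ωhat' : AlternatingMap ℝ W ℝ (Fin 3),
        (IsDecomposable (cx Ω + Complex.I • cx Ωhat') ∧
            ∃ c : ℝ, 0 < c ∧ wedge Ω Ωhat' = c • ε) →
          Ωhat' = Ωhat := by
  obtain ⟨μ, hμ⟩ := K_sq hdim ε hε Ω (K Ω) (hK Ω)
  have hlμ : lam Ω = μ := by rw [hlam, trace_sq hdim (K Ω) μ hμ]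
  obtain ⟨Ω', hΩ'⟩ := exists_prime hdim ε hε Ω (K Ω) (hK Ω)
  rw [hlμ] at hΩ
  rw [hlμ]
  set s := Real.sqrt (-μ) with hsdef
  have hs : 0 < s := Real.sqrt_pos.2 (by linarith)
  have hs2 : s * s = -μ := Real.mul_self_sqrt (by linarith)
  have hKK : ∀ x, K Ω (K Ω x) = μ • x := fun x => LinearMap.congr_fun hμ x
  have hh : ∀ x y z, (s⁻¹ • Ω') ![x,y,z] = s⁻¹ * Ω ![K Ω x, y, z] := fun x y z => by
    rw [← hΩ']; rfl
  set Ωh : AlternatingMap ℝ W ℝ (Fin 3) := s⁻¹ • Ω' with hΩh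
  have hΩK : ∀ x y z, Ω ![K Ω x, y, z] = s * Ωh ![x,y,z] := by
    intro x y z; rw [hh]; field_simp
  have hΩhK : ∀ x y z, Ωh ![K Ω x, y, z] = -s * Ω ![x,y,z] := by
    intro x y z
    rw [hh, hKK, slot1_smul, show μ = -(s * s) by linarith]
    field_simp
  have hΩ0 : Ω ≠ 0 := by
    intro h0
    have b : Module.Basis (Fin 6) ℝ W := Module.finBasisOfFinrankEq ℝ W hdim
    have hcf : cf Ω b = 0 := by subst h0; rfl
    have hK0 : ∀ i, b.coord i (K Ω (b 0)) = 0 := by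
      intro i
      have h1 := coordK_cf ε Ω (K Ω) (hK Ω) b i 0
      rw [hcf] at h1
      have h2 : ε b * b.coord i (K Ω (b 0)) = 0 := by rw [h1]; simp [kf]
      exact (mul_eq_zero.1 h2).resolve_left (vol_ne ε hε b)
    have h1 : K Ω (b 0) = 0 := by rw [Kexp (K Ω) b 0]; simp only [hK0]; simp
    have h2 := hKK (b 0)
    rw [h1, map_zero] at h2
    rcases smul_eq_zero.1 h2.symm with h | h
    · exact hΩ.ne h
    · exact b.ne_zero 0 h
  have hΩh0 : Ωh ≠ 0 := by
    intro h0
    apply hΩ0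
    refine ext3_s9 _ _ fun x y z => ?_
    have h1 := hΩhK x y z
    rw [h0] at h1
    have h2 : -s * Ω ![x,y,z] = 0 := h1.symm
    exact (mul_eq_zero.1 h2).resolve_left (by linarith)
  have hα0 : cx Ω + Complex.I • cx Ωh ≠ 0 := by
    intro h0
    apply hΩ0
    ext v
    have h1 := cxI_apply Ω Ωh v
    rw [h0] at h1
    exact (congrArg Complex.re h1).symm
  have hβ0 : cx Ωh + Complex.I • cx (-Ω) ≠ 0 := by
    intro h0
    apply hΩh0
    ext v
    have h1 := cxI_apply Ωh (-Ω) v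
    rw [h0] at h1
    exact (congrArg Complex.re h1).symm
  obtain ⟨ξ, hξi, hξ⟩ := decomp_of_eigen hdim (K Ω) s hs _ hα0 (by
    intro x y z
    rw [cxI_apply, cxI_apply, hΩK, hΩhK]
    apply Complex.ext <;> simp)
  obtain ⟨η, hηi, hη⟩ := decomp_of_eigen hdim (K Ω) s hs _ hβ0 (by
    intro x y z
    rw [cxI_apply, cxI_apply, AlternatingMap.neg_apply, AlternatingMap.neg_apply, hΩK, hΩhK]
    apply Complex.ext <;> simp)
  obtain ⟨c, hc1, hc2, hc3⟩ := nf_main hdim ε hε Ω Ωh (K Ω) (hK Ω) ξ hξi hξ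
  obtain ⟨d, hd1, hd2, hd3⟩ := nf_main hdim ε hε Ωh (-Ω) (K Ωh) (hK Ωh) η hηi hη
  have hdc : d = c := wedge_coeff_swap hdim ε hε Ω Ωh c d hc1 hd1
  have hcs : c = 2 * s := by
    by_contra hne
    apply hΩh0
    refine ext3_s9 _ _ fun x y z => ?_
    have h1 := hc2 x y z
    rw [hΩK] at h1
    have h2 : (c - 2 * s) * Ωh ![x,y,z] = 0 := by linarith
    exact (mul_eq_zero.1 h2).resolve_left (sub_ne_zero.2 hne)
  subst hdc
  subst hcs
  refine ⟨Ωh, ⟨⟨ξ 0, ξ 1, ξ 2, hξ⟩, ⟨2 * s, by linarith, hc1⟩, hc1, ?_, ⟨η 0, η 1, η 2, hη⟩,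
    ⟨2 * s, by linarith, hd1⟩⟩, ?_⟩
  · rw [hlam, trace_sq hdim (K Ωh) _ hd3]
    linarith
  · rintro Ψ ⟨⟨ξ₁, ξ₂, ξ₃, hΨ⟩, c, hc, hw⟩
    have hinj := inj_of_wedge hdim ε hε Ω Ψ c hc.ne' hw ![ξ₁, ξ₂, ξ₃] hΨ
    obtain ⟨c', h1, h2, h3⟩ := nf_main hdim ε hε Ω Ψ (K Ω) (hK Ω) ![ξ₁, ξ₂, ξ₃] hinj hΨ
    have hcc : c' = c := smul_inj ε hε c' c _ h1 hw
    subst hcc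
    have h4 : -(c' / 2) ^ 2 = μ := by
      rw [← trace_sq hdim (K Ω) _ h3, trace_sq hdim (K Ω) μ hμ]
    have h5 : c' / 2 = s := by nlinarith
    refine ext3_s9 _ _ fun x y z => ?_
    have h6 := h2 x y z
    rw [h5, hΩK] at h6
    exact (mul_left_cancel₀ hs.ne' h6).symm
end
end
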